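/- Let g ∼ N(0, I_m), h ∼ N(0, I_n), 1 ≤ m < n, δ = (m−1)/n, λ ≥ 0, 1 ≤ p ≤ ∞, and A > 0. Define φ(α,β;g,h) = β‖(α/√n)g − e₁‖₂ − (α/√n)·dist(βh, {w : ‖w‖_{p*} ≤ λ}) and κ(α,β) = β·sqrt(δα² + 1) − α·Δ_p(β), where Δ_p(β) = (1/√n)·E_{h}[dist(βh, {w : ‖w‖_{p*} ≤ λ})]. Then there exist universal constants c₁, c₂ > 0 such that for any 0 < ε < 2, P[ ∃ 0 < α ≤ A, 0 < β < 1 with |φ(α,β;g,h) − κ(α,β)| ≥ ε ] ≤ (c₁/ε)·e^{−c₂ ε² n · min(δ, 1/A²)/(1 + δ A²)}. -/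

import Mathlib

open MeasureTheory ProbabilityTheory Filter
open scoped ENNReal NNReal

/-- The standard Gaussian measure `N(0, I_n)` on `ℝ^n`. -/
noncomputable def stdGaussian (n : ℕ) : Measure (Fin n → ℝ) :=
  Measure.pi fun _ => gaussianReal 0 1

/-- The Euclidean (`ℓ²`) norm on `ℝ^n`. -/
noncomputable def l2norm {n : ℕ} (x : Fin n → ℝ) : ℝ := Real.sqrt (∑ i, x i ^ 2)

/-- The `ℓ^q` norm on `ℝ^n` for an extended exponent `q ∈ [1, ∞]`. -/
noncomputable def lqNorm {n : ℕ} (q : ℝ≥0∞) (x : Fin n → ℝ) : ℝ :=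
  if q = ⊤ then ⨆ i, |x i| else (∑ i, |x i| ^ q.toReal) ^ (1 / q.toReal)

/-- Euclidean distance from `h ∈ ℝ^n` to a set `C ⊆ ℝ^n`. -/
noncomputable def distL2 {n : ℕ} (C : Set (Fin n → ℝ)) (h : Fin n → ℝ) : ℝ :=
  sInf ((fun w => l2norm (h - w)) '' C)

/-- The first canonical basis vector of `ℝ^m`. -/
def e1 (m : ℕ) : Fin m → ℝ := fun i => if (i : ℕ) = 0 then 1 else 0

/-- `Δ_p(β) = (1/√n) E_{h ∼ N(0,I_n)} dist(β h, {w : ‖w‖_{p*} ≤ λ})`, in terms of the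
conjugate exponent `q = p*`. -/
noncomputable def Deltap (q : ℝ≥0∞) (lam : ℝ) (n : ℕ) (β : ℝ) : ℝ :=
  (1 / Real.sqrt n) * ∫ h, distL2 {w | lqNorm q w ≤ lam} (β • h) ∂stdGaussian n

/-- `φ(α, β; g, h) = β ‖(α/√n) g − e₁‖₂ − (α/√n) dist(β h, {w : ‖w‖_{p*} ≤ λ})`. -/
noncomputable def phiFun (q : ℝ≥0∞) (lam : ℝ) (m n : ℕ) (α β : ℝ)
    (g : Fin m → ℝ) (h : Fin n → ℝ) : ℝ :=
  β * l2norm ((α / Real.sqrt n) • g - e1 m) -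
    (α / Real.sqrt n) * distL2 {w | lqNorm q w ≤ lam} (β • h)

/-- `κ(α, β) = β √(δα² + 1) − α Δ_p(β)`. -/
noncomputable def kappaFun (q : ℝ≥0∞) (lam : ℝ) (n : ℕ) (δ α β : ℝ) : ℝ :=
  β * Real.sqrt (δ * α ^ 2 + 1) - α * Deltap q lam n β

/-! ### Concentration of Gaussian measure via the Prékopa–Leindler inequality -/

lemma volume_add_le_two_mul_of_midpoint_mem {A B D : Set ℝ} (hA : MeasurableSet A)
    (hB : MeasurableSet B) (hA0 : A.Nonempty) (hB0 : B.Nonempty)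
    (hD : ∀ x ∈ A, ∀ y ∈ B, (x + y) / 2 ∈ D) :
    volume A + volume B ≤ 2 * volume D := by
  have key : ∀ K L : Set ℝ, IsCompact K → IsCompact L → K.Nonempty → L.Nonempty → K ⊆ A → L ⊆ B →
      volume K + volume L ≤ 2 * volume D := by
    intro K L hK hL hK0 hL0 hKA hLB
    obtain ⟨a, haK, ha⟩ := hK.exists_isGreatest hK0
    obtain ⟨b, hbL, hb⟩ := hL.exists_isLeast hL0
    set K' : Set ℝ := (fun x => (2 : ℝ) * x + (-b)) ⁻¹' K with hK'
    set L' : Set ℝ := (fun x => (2 : ℝ) * x + (-a)) ⁻¹' L with hL'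
    have hvol : ∀ (c : ℝ) (S : Set ℝ), 2 * volume ((fun x => (2 : ℝ) * x + c) ⁻¹' S) = volume S := by
      intro c S
      have : (fun x => (2 : ℝ) * x + c) ⁻¹' S = (fun x => (2 : ℝ) * x) ⁻¹' ((fun x => x + c) ⁻¹' S) := rfl
      rw [this, Real.volume_preimage_mul_left (by norm_num), measure_preimage_add_right, ← mul_assoc]
      rw [show (2 : ℝ≥0∞) = ENNReal.ofReal 2 by simp, ← ENNReal.ofReal_mul (by norm_num)]
      norm_num [abs_of_pos]
    have hL'm : MeasurableSet L' := by
      apply hL.measurableSet.preimage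
      fun_prop
    have hsub : K' ∪ L' ⊆ D := by
      rintro x (hx | hx)
      · have := hD _ (hKA hx) _ (hLB hbL)
        convert this using 1; ring
      · have := hD _ (hKA haK) _ (hLB hx)
        convert this using 1; ring
    have hdisj : AEDisjoint volume K' L' := by
      refine measure_mono_null (t := {(a + b) / 2}) ?_ (by simp)
      rintro x ⟨hx1, hx2⟩
      have h1 := ha hx1
      have h2 := hb hx2
      simp only [Set.mem_singleton_iff]
      simp only at h1 h2
      linarith
    calc volume K + volume L = 2 * (volume K' + volume L') := by
          rw [mul_add, hvol, hvol]
      _ = 2 * volume (K' ∪ L') := by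
          rw [measure_union₀ hL'm.nullMeasurableSet hdisj]
      _ ≤ _ := by gcongr
  obtain ⟨x0, hx0⟩ := hA0
  obtain ⟨y0, hy0⟩ := hB0
  rw [hA.measure_eq_iSup_isCompact, hB.measure_eq_iSup_isCompact]
  simp only [iSup_and']
  refine ENNReal.biSup_add_biSup_le' (p := fun K => K ⊆ A ∧ IsCompact K)
    (q := fun K => K ⊆ B ∧ IsCompact K) ⟨∅, by simp⟩ ⟨∅, by simp⟩ ?_
  rintro K ⟨hKA, hK⟩ L ⟨hLB, hL⟩
  refine le_trans (add_le_add (measure_mono (Set.subset_insert x0 K))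
    (measure_mono (Set.subset_insert y0 L))) (key _ _ (hK.insert _) (hL.insert _)
      (Set.insert_nonempty _ _) (Set.insert_nonempty _ _) ?_ ?_)
  · exact Set.insert_subset hx0 hKA
  · exact Set.insert_subset hy0 hLB

lemma ENNReal.mul_le_sq_of_add_le_two_mul {u v w : ℝ≥0∞} (huv : u + v ≤ 2 * w) :
    u * v ≤ w ^ 2 := by
  by_cases hw : w = ∞
  · simp [hw]
  have hsum : u + v ≠ ∞ := ne_top_of_le_ne_top (ENNReal.mul_ne_top (by simp) hw) huv
  obtain ⟨hu, hv⟩ := ENNReal.add_ne_top.1 hsum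
  lift u to ℝ≥0 using hu
  lift v to ℝ≥0 using hv
  lift w to ℝ≥0 using hw
  norm_cast at huv ⊢
  have h1 : (u : ℝ) + v ≤ 2 * w := by exact_mod_cast huv
  have h2 : (u : ℝ) * v ≤ w ^ 2 := by
    nlinarith [sq_nonneg ((u : ℝ) - v), u.coe_nonneg, v.coe_nonneg, w.coe_nonneg]
  exact_mod_cast h2

lemma lintegral_mul_lintegral_le_sq {U V W : ℝ → ℝ} (hU : Measurable U) (hV : Measurable V)
    (hW : Measurable W) (hU0 : ∀ x, 0 ≤ U x) (hV0 : ∀ x, 0 ≤ V x) (hW0 : ∀ x, 0 ≤ W x)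
    (hW1 : ∀ x, W x ≤ 1) (h : ∀ x y, U x * V y ≤ W ((x + y) / 2) ^ 2) :
    (∫⁻ x, ENNReal.ofReal (U x)) * (∫⁻ x, ENNReal.ofReal (V x)) ≤
      (∫⁻ x, ENNReal.ofReal (W x)) ^ 2 := by
  by_cases hU' : ∃ x, 0 < U x
  swap
  · push Not at hU'
    have : ∀ x, ENNReal.ofReal (U x) = 0 := fun x => by simpa using hU' x
    simp [this]
  by_cases hV' : ∃ x, 0 < V x
  swap
  · push Not at hV'
    have : ∀ x, ENNReal.ofReal (V x) = 0 := fun x => by simpa using hV' x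
    simp [this]
  obtain ⟨x0, hx0⟩ := hU'
  obtain ⟨y0, hy0⟩ := hV'
  have hUV : ∀ x y, U x * V y ≤ 1 := fun x y =>
    (h x y).trans (pow_le_one₀ (hW0 _) (hW1 _))
  have hbU : BddAbove (Set.range U) := ⟨1 / V y0, by
    rintro _ ⟨x, rfl⟩
    rw [le_div_iff₀ hy0]; exact hUV _ _⟩
  have hbV : BddAbove (Set.range V) := ⟨1 / U x0, by
    rintro _ ⟨x, rfl⟩
    rw [le_div_iff₀ hx0, mul_comm]; exact hUV _ _⟩
  set a := sSup (Set.range U)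
  set b := sSup (Set.range V)
  have ha : 0 < a := hx0.trans_le (le_csSup hbU ⟨x0, rfl⟩)
  have hb : 0 < b := hy0.trans_le (le_csSup hbV ⟨y0, rfl⟩)
  set c := Real.sqrt (a * b)
  have hc : 0 < c := Real.sqrt_pos.2 (by positivity)
  have hc2 : c ^ 2 = a * b := Real.sq_sqrt (by positivity)
  have level : ∀ t ∈ Set.Ioi (0 : ℝ), volume {x | t < U x / a} + volume {x | t < V x / b} ≤
      2 * volume {x | t < W x / c} := by
    intro t ht
    rw [Set.mem_Ioi] at ht
    by_cases ht1 : t < 1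
    · apply volume_add_le_two_mul_of_midpoint_mem
      · exact measurableSet_lt measurable_const (hU.div_const _)
      · exact measurableSet_lt measurable_const (hV.div_const _)
      · obtain ⟨_, ⟨x, rfl⟩, hx⟩ := exists_lt_of_lt_csSup (Set.range_nonempty U)
          (show t * a < a by nlinarith)
        exact ⟨x, by rwa [Set.mem_ofPred_eq, lt_div_iff₀ ha]⟩
      · obtain ⟨_, ⟨x, rfl⟩, hx⟩ := exists_lt_of_lt_csSup (Set.range_nonempty V)
          (show t * b < b by nlinarith)
        exact ⟨x, by rwa [Set.mem_ofPred_eq, lt_div_iff₀ hb]⟩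
      · intro x hx y hy
        simp only [Set.mem_ofPred_eq] at hx hy ⊢
        rw [lt_div_iff₀ ha] at hx
        rw [lt_div_iff₀ hb] at hy
        rw [lt_div_iff₀ hc]
        refine lt_of_pow_lt_pow_left₀ 2 (hW0 _) (lt_of_lt_of_le ?_ (h x y))
        calc (t * c) ^ 2 = (t * a) * (t * b) := by rw [mul_pow, hc2]; ring
          _ < U x * V y := by gcongr
    · have e1 : {x | t < U x / a} = ∅ := by
        ext x
        simp only [Set.mem_ofPred_eq, Set.mem_empty_iff_false, iff_false, not_lt]
        refine le_trans ?_ (not_lt.1 ht1)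
        rw [div_le_one ha]; exact le_csSup hbU ⟨x, rfl⟩
      have e2 : {x | t < V x / b} = ∅ := by
        ext x
        simp only [Set.mem_ofPred_eq, Set.mem_empty_iff_false, iff_false, not_lt]
        refine le_trans ?_ (not_lt.1 ht1)
        rw [div_le_one hb]; exact le_csSup hbV ⟨x, rfl⟩
      simp [e1, e2]
  have cake : ∀ (F : ℝ → ℝ) (d : ℝ), Measurable F → (∀ x, 0 ≤ F x) → 0 < d →
      ∫⁻ x, ENNReal.ofReal (F x) = ENNReal.ofReal d * ∫⁻ t in Set.Ioi 0, volume {x | t < F x / d} := by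
    intro F d hF hF0 hd
    rw [← lintegral_eq_lintegral_meas_lt volume (Eventually.of_forall fun x => by
      have := hF0 x; simp only [Pi.zero_apply]; positivity) (hF.div_const _).aemeasurable,
      ← lintegral_const_mul _ (by fun_prop)]
    refine lintegral_congr fun x => ?_
    rw [← ENNReal.ofReal_mul hd.le]
    congr 1; field_simp
  rw [cake U a hU hU0 ha, cake V b hV hV0 hb, cake W c hW hW0 hc]
  set u := ∫⁻ t in Set.Ioi 0, volume {x | t < U x / a}
  set v := ∫⁻ t in Set.Ioi 0, volume {x | t < V x / b}
  set w := ∫⁻ t in Set.Ioi 0, volume {x | t < W x / c}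
  have hmeas : ∀ (F : ℝ → ℝ), Measurable fun t : ℝ => volume {x | t < F x} := fun F =>
    Antitone.measurable fun s t hst => measure_mono fun x (hx : t < F x) => lt_of_le_of_lt hst hx
  have huv : u + v ≤ 2 * w := by
    rw [← lintegral_add_left (hmeas _), ← lintegral_const_mul _ (hmeas _)]
    exact setLIntegral_mono' measurableSet_Ioi level
  have hmul : u * v ≤ w ^ 2 := ENNReal.mul_le_sq_of_add_le_two_mul huv
  calc ENNReal.ofReal a * u * (ENNReal.ofReal b * v)
      = ENNReal.ofReal (a * b) * (u * v) := by rw [ENNReal.ofReal_mul ha.le]; ring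
    _ ≤ ENNReal.ofReal (a * b) * w ^ 2 := by gcongr
    _ = (ENNReal.ofReal c * w) ^ 2 := by
        rw [← hc2, mul_pow, ENNReal.ofReal_pow hc.le]

/-! ### Euclidean norm and distance -/

section Euclid

variable {n : ℕ}

lemma l2norm_eq_norm (x : Fin n → ℝ) : l2norm x = ‖(WithLp.toLp 2 x : EuclideanSpace ℝ (Fin n))‖ := by
  simp [l2norm, EuclideanSpace.norm_eq]

lemma l2norm_nonneg (x : Fin n → ℝ) : 0 ≤ l2norm x := Real.sqrt_nonneg _

lemma l2norm_sq (x : Fin n → ℝ) : l2norm x ^ 2 = ∑ i, x i ^ 2 :=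
  Real.sq_sqrt (Finset.sum_nonneg fun _ _ => sq_nonneg _)

lemma l2norm_add_le (x y : Fin n → ℝ) : l2norm (x + y) ≤ l2norm x + l2norm y := by
  simp only [l2norm_eq_norm, WithLp.toLp_add]
  exact norm_add_le _ _

lemma l2norm_smul (c : ℝ) (x : Fin n → ℝ) : l2norm (c • x) = |c| * l2norm x := by
  simp only [l2norm_eq_norm, WithLp.toLp_smul, norm_smul, Real.norm_eq_abs]

lemma l2norm_neg (x : Fin n → ℝ) : l2norm (-x) = l2norm x := by
  simp [l2norm]

lemma l2norm_sub_comm (x y : Fin n → ℝ) : l2norm (x - y) = l2norm (y - x) := by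
  rw [← l2norm_neg, neg_sub]

lemma l2norm_sub_le (x y z : Fin n → ℝ) : l2norm (x - z) ≤ l2norm (x - y) + l2norm (y - z) := by
  have := l2norm_add_le (x - y) (y - z)
  rwa [sub_add_sub_cancel] at this

lemma abs_le_l2norm (x : Fin n → ℝ) (i : Fin n) : |x i| ≤ l2norm x := by
  rw [← Real.sqrt_sq_eq_abs]
  exact Real.sqrt_le_sqrt (Finset.single_le_sum (f := fun i => x i ^ 2)
    (fun _ _ => sq_nonneg _) (Finset.mem_univ i))

lemma continuous_l2norm : Continuous (l2norm : (Fin n → ℝ) → ℝ) := by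
  unfold l2norm; fun_prop

lemma sum_mul_le_l2norm_mul (x y : Fin n → ℝ) : ∑ i, x i * y i ≤ l2norm x * l2norm y :=
  Real.sum_mul_le_sqrt_mul_sqrt _ _ _

lemma distL2_bddBelow (C : Set (Fin n → ℝ)) (h : Fin n → ℝ) :
    BddBelow ((fun w => l2norm (h - w)) '' C) :=
  ⟨0, by rintro _ ⟨w, -, rfl⟩; exact l2norm_nonneg _⟩

lemma distL2_le {C : Set (Fin n → ℝ)} {w : Fin n → ℝ} (hw : w ∈ C) (h : Fin n → ℝ) :
    distL2 C h ≤ l2norm (h - w) :=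
  csInf_le (distL2_bddBelow C h) ⟨w, hw, rfl⟩

lemma distL2_nonneg (C : Set (Fin n → ℝ)) (h : Fin n → ℝ) : 0 ≤ distL2 C h :=
  Real.sInf_nonneg (by rintro _ ⟨w, -, rfl⟩; exact l2norm_nonneg _)

lemma le_distL2 {C : Set (Fin n → ℝ)} (hC : C.Nonempty) {h : Fin n → ℝ} {a : ℝ}
    (ha : ∀ w ∈ C, a ≤ l2norm (h - w)) : a ≤ distL2 C h :=
  le_csInf (hC.image _) (by rintro _ ⟨w, hw, rfl⟩; exact ha w hw)

lemma distL2_le_add {C : Set (Fin n → ℝ)} (hC : C.Nonempty) (x y : Fin n → ℝ) :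
    distL2 C x ≤ distL2 C y + l2norm (x - y) := by
  rw [← sub_le_iff_le_add]
  refine le_distL2 hC fun w hw => ?_
  have := l2norm_sub_le x y w
  linarith [distL2_le hw x]

lemma continuous_distL2 {C : Set (Fin n → ℝ)} (hC : C.Nonempty) : Continuous (distL2 C) := by
  rw [continuous_iff_continuousAt]
  intro x
  refine tendsto_iff_dist_tendsto_zero.2 ?_
  have hlim : Tendsto (fun y => l2norm (y - x)) (nhds x) (nhds 0) := by
    have : Continuous fun y => l2norm (y - x) := continuous_l2norm.comp (by fun_prop)
    convert this.tendsto x using 2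
    simp [l2norm]
  refine squeeze_zero (fun _ => dist_nonneg) (fun y => ?_) hlim
  rw [Real.dist_eq, abs_le]
  constructor
  · have := distL2_le_add hC x y
    rw [l2norm_sub_comm] at this
    linarith
  · linarith [distL2_le_add hC y x]

end Euclid

instance isProbabilityMeasure_stdGaussian (n : ℕ) : IsProbabilityMeasure (_root_.stdGaussian n) := by
  unfold _root_.stdGaussian; infer_instance

lemma lintegral_gaussianReal_mul_le_one {u v : ℝ → ℝ≥0∞} (hu : Measurable u) (hv : Measurable v)
    (h : ∀ x y, u x * v y ≤ ENNReal.ofReal (Real.exp ((x - y) ^ 2 / 4))) :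
    (∫⁻ x, u x ∂gaussianReal 0 1) * (∫⁻ x, v x ∂gaussianReal 0 1) ≤ 1 := by
  by_cases hu0 : ∀ x, u x = 0
  · simp [hu0]
  by_cases hv0 : ∀ x, v x = 0
  · simp [hv0]
  push Not at hu0 hv0
  obtain ⟨x0, hx0⟩ := hu0
  obtain ⟨y0, hy0⟩ := hv0
  have hut : ∀ x, u x ≠ ∞ := fun x hx => by
    have := h x y0
    rw [hx, ENNReal.top_mul hy0] at this
    exact absurd this (by simp)
  have hvt : ∀ x, v x ≠ ∞ := fun x hx => by
    have := h x0 x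
    rw [hx, ENNReal.mul_top hx0] at this
    exact absurd this (by simp)
  have key := lintegral_mul_lintegral_le_sq (U := fun x => (u x).toReal * gaussianPDFReal 0 1 x)
    (V := fun x => (v x).toReal * gaussianPDFReal 0 1 x) (W := gaussianPDFReal 0 1)
    (hu.ennreal_toReal.mul (measurable_gaussianPDFReal 0 1))
    (hv.ennreal_toReal.mul (measurable_gaussianPDFReal 0 1)) (measurable_gaussianPDFReal 0 1)
    (fun x => mul_nonneg ENNReal.toReal_nonneg (gaussianPDFReal_nonneg 0 1 x))
    (fun x => mul_nonneg ENNReal.toReal_nonneg (gaussianPDFReal_nonneg 0 1 x))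
    (gaussianPDFReal_nonneg 0 1) ?_ ?_
  · have e : ∀ w : ℝ → ℝ≥0∞, Measurable w → (∀ x, w x ≠ ∞) → ∫⁻ x, w x ∂gaussianReal 0 1 =
        ∫⁻ x, ENNReal.ofReal ((w x).toReal * gaussianPDFReal 0 1 x) := by
      intro w hw hwt
      rw [gaussianReal_of_var_ne_zero _ one_ne_zero, lintegral_withDensity_eq_lintegral_mul _
        (measurable_gaussianPDF 0 1) hw]
      refine lintegral_congr fun x => ?_
      rw [ENNReal.ofReal_mul ENNReal.toReal_nonneg, ENNReal.ofReal_toReal (hwt x)]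
      simp [gaussianPDF, mul_comm]
    rw [e u hu hut, e v hv hvt]
    refine key.trans ?_
    rw [lintegral_gaussianPDFReal_eq_one 0 one_ne_zero, one_pow]
  · intro x
    rw [gaussianPDFReal_def]
    simp only [NNReal.coe_one, mul_one, sub_zero]
    refine mul_le_one₀ ?_ (Real.exp_nonneg _) ?_
    · apply inv_le_one_of_one_le₀
      rw [Real.one_le_sqrt]
      nlinarith [Real.pi_gt_three]
    · rw [Real.exp_le_one_iff, neg_div]
      have : 0 ≤ x ^ 2 / 2 := by positivity
      linarith
  · intro x y
    have h1 : (u x).toReal * (v y).toReal ≤ Real.exp ((x - y) ^ 2 / 4) := by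
      rw [← ENNReal.toReal_mul]
      exact ENNReal.toReal_le_of_le_ofReal (Real.exp_nonneg _) (h x y)
    have h2 : Real.exp ((x - y) ^ 2 / 4) * (gaussianPDFReal 0 1 x * gaussianPDFReal 0 1 y) =
        gaussianPDFReal 0 1 ((x + y) / 2) ^ 2 := by
      simp only [gaussianPDFReal_def, NNReal.coe_one, mul_one, sub_zero]
      rw [mul_pow, ← Real.exp_nat_mul, mul_mul_mul_comm, ← Real.exp_add, mul_left_comm,
        ← Real.exp_add]
      ring_nf
    rw [← h2]
    calc _ = (u x).toReal * (v y).toReal * (gaussianPDFReal 0 1 x * gaussianPDFReal 0 1 y) := by ring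
      _ ≤ _ := by
        gcongr
        exact mul_nonneg (gaussianPDFReal_nonneg _ _ _) (gaussianPDFReal_nonneg _ _ _)

lemma lintegral_stdGaussian_succ (n : ℕ) {u : (Fin (n + 1) → ℝ) → ℝ≥0∞} (hu : Measurable u) :
    ∫⁻ x, u x ∂_root_.stdGaussian (n + 1) =
      ∫⁻ a, ∫⁻ z, u (Fin.cons a z) ∂_root_.stdGaussian n ∂gaussianReal 0 1 := by
  have := (measurePreserving_piFinSuccAbove (fun _ : Fin (n + 1) => gaussianReal 0 1) 0).symm
  unfold _root_.stdGaussian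
  rw [← this.lintegral_comp hu, lintegral_prod]
  · refine lintegral_congr fun a => lintegral_congr fun z => congrArg u ?_
    exact Fin.insertNth_zero' a z
  · exact (hu.comp (MeasurableEquiv.measurable _)).aemeasurable

lemma measurable_finCons {n : ℕ} :
    Measurable fun p : ℝ × (Fin n → ℝ) => (Fin.cons p.1 p.2 : Fin (n + 1) → ℝ) := by
  refine measurable_pi_iff.2 fun i => ?_
  refine Fin.cases ?_ (fun j => ?_) i
  · simpa using measurable_fst
  · exact (measurable_pi_apply j).comp measurable_snd

lemma lintegral_stdGaussian_mul_le_one (n : ℕ) {u v : (Fin n → ℝ) → ℝ≥0∞} (hu : Measurable u)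
    (hv : Measurable v)
    (h : ∀ x y, u x * v y ≤ ENNReal.ofReal (Real.exp ((∑ i, (x i - y i) ^ 2) / 4))) :
    (∫⁻ x, u x ∂_root_.stdGaussian n) * (∫⁻ x, v x ∂_root_.stdGaussian n) ≤ 1 := by
  induction n with
  | zero =>
    have e : ∀ w : (Fin 0 → ℝ) → ℝ≥0∞, ∫⁻ x, w x ∂_root_.stdGaussian 0 = w default := by
      intro w
      rw [lintegral_congr (g := fun _ => w default) (fun x => by rw [Subsingleton.elim x default])]
      simp
    rw [e, e]
    simpa using h default default
  | succ n ih =>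
    rw [lintegral_stdGaussian_succ n hu, lintegral_stdGaussian_succ n hv]
    have hu' : Measurable fun p : ℝ × (Fin n → ℝ) => u (Fin.cons p.1 p.2) :=
      hu.comp measurable_finCons
    have hv' : Measurable fun p : ℝ × (Fin n → ℝ) => v (Fin.cons p.1 p.2) :=
      hv.comp measurable_finCons
    refine lintegral_gaussianReal_mul_le_one hu'.lintegral_prod_right' hv'.lintegral_prod_right' ?_
    intro a b
    set E := ENNReal.ofReal (Real.exp ((a - b) ^ 2 / 4)) with hE
    have hE0 : E ≠ 0 := by simp [hE, Real.exp_pos]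
    have hEt : E ≠ ∞ := by simp [hE]
    have hua : Measurable fun z => u (Fin.cons a z) := hu'.comp measurable_prodMk_left
    have := ih (u := fun z => E⁻¹ * u (Fin.cons a z)) (v := fun z => v (Fin.cons b z))
      (hua.const_mul _) (hv'.comp measurable_prodMk_left) ?_
    · rw [lintegral_const_mul _ hua, mul_assoc] at this
      rwa [ENNReal.inv_mul_le_iff hE0 hEt, mul_one] at this
    · intro z w
      rw [mul_assoc, ENNReal.inv_mul_le_iff hE0 hEt]
      refine (h _ _).trans_eq ?_
      rw [hE, ← ENNReal.ofReal_mul (Real.exp_nonneg _), ← Real.exp_add]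
      simp only [Fin.sum_univ_succ, Fin.cons_zero, Fin.cons_succ]
      congr 2; ring

/-- Gaussian concentration around a set of measure at least one half. -/
lemma lintegral_exp_distL2_le {n : ℕ} {K : Set (Fin n → ℝ)}
    (hK : 1 / 2 ≤ _root_.stdGaussian n K) :
    ∫⁻ x, ENNReal.ofReal (Real.exp (distL2 K x ^ 2 / 4)) ∂_root_.stdGaussian n ≤ 2 := by
  have hK0 : K.Nonempty := by
    rw [Set.nonempty_iff_ne_empty]
    rintro rfl
    simp at hK
  have hc := continuous_distL2 hK0
  set K' : Set (Fin n → ℝ) := {y | distL2 K y = 0} with hK'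
  have hK'm : MeasurableSet K' := (isClosed_eq hc continuous_const).measurableSet
  have hsub : K ⊆ K' := fun y hy =>
    le_antisymm ((distL2_le hy y).trans_eq (by simp [l2norm])) (distL2_nonneg _ _)
  have key := lintegral_stdGaussian_mul_le_one n
    (u := fun x => ENNReal.ofReal (Real.exp (distL2 K x ^ 2 / 4))) (v := K'.indicator 1)
    (by fun_prop) (measurable_one.indicator hK'm) ?_
  · rw [lintegral_indicator_one hK'm] at key
    have h2 : (1 / 2 : ℝ≥0∞) ≤ _root_.stdGaussian n K' := hK.trans (measure_mono hsub)
    have h3 := (mul_le_mul_right h2 _).trans key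
    rw [one_div, ← div_eq_mul_inv, ENNReal.div_le_iff (by simp) (by simp), one_mul] at h3
    exact h3
  · intro x y
    by_cases hy : y ∈ K'
    · simp only [Set.indicator_of_mem hy, Pi.one_apply, mul_one]
      refine ENNReal.ofReal_le_ofReal (Real.exp_le_exp.2 ?_)
      have h1 := distL2_le_add hK0 x y
      rw [show distL2 K y = 0 from hy, zero_add] at h1
      have h2 : distL2 K x ^ 2 ≤ l2norm (x - y) ^ 2 :=
        pow_le_pow_left₀ (distL2_nonneg _ _) h1 2
      rw [l2norm_sq] at h2
      simp only [Pi.sub_apply] at h2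
      linarith
    · simp [Set.indicator_of_notMem hy]

lemma stdGaussian_distL2_ge_le {n : ℕ} {K : Set (Fin n → ℝ)}
    (hK : 1 / 2 ≤ _root_.stdGaussian n K) {t : ℝ} (ht : 0 ≤ t) :
    _root_.stdGaussian n {x | t ≤ distL2 K x} ≤ ENNReal.ofReal (2 * Real.exp (-(t ^ 2 / 4))) := by
  have hK0 : K.Nonempty := by
    rw [Set.nonempty_iff_ne_empty]
    rintro rfl
    simp at hK
  have hc := continuous_distL2 hK0
  have h1 := mul_meas_ge_le_lintegral₀ (μ := _root_.stdGaussian n)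
    (f := fun x => ENNReal.ofReal (Real.exp (distL2 K x ^ 2 / 4))) (by fun_prop)
    (ENNReal.ofReal (Real.exp (t ^ 2 / 4)))
  have h2 := h1.trans (lintegral_exp_distL2_le hK)
  rw [mul_comm, ← ENNReal.le_div_iff_mul_le (by simp [Real.exp_pos]) (by simp)] at h2
  refine (measure_mono ?_).trans (h2.trans_eq ?_)
  · intro x hx
    simp only [Set.mem_ofPred_eq] at hx ⊢
    gcongr
  · rw [Real.exp_neg, ENNReal.ofReal_mul (by norm_num), ENNReal.ofReal_inv_of_pos (Real.exp_pos _)]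
    simp [div_eq_mul_inv]

lemma integrable_distL2 {n : ℕ} {K : Set (Fin n → ℝ)} (hK : 1 / 2 ≤ _root_.stdGaussian n K) :
    Integrable (distL2 K) (_root_.stdGaussian n) ∧ ∫ x, distL2 K x ∂_root_.stdGaussian n ≤ 4 := by
  have hK0 : K.Nonempty := by
    rw [Set.nonempty_iff_ne_empty]
    rintro rfl
    simp at hK
  have hc := continuous_distL2 hK0
  have hle : ∀ x, ENNReal.ofReal (distL2 K x) ≤
      2 * ENNReal.ofReal (Real.exp (distL2 K x ^ 2 / 4)) := by
    intro x
    rw [show (2 : ℝ≥0∞) = ENNReal.ofReal 2 by simp, ← ENNReal.ofReal_mul (by norm_num)]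
    refine ENNReal.ofReal_le_ofReal ?_
    nlinarith [Real.add_one_le_exp (distL2 K x ^ 2 / 4), sq_nonneg (distL2 K x - 2)]
  have hint : ∫⁻ x, ENNReal.ofReal (distL2 K x) ∂_root_.stdGaussian n ≤ 4 := by
    calc _ ≤ ∫⁻ x, 2 * ENNReal.ofReal (Real.exp (distL2 K x ^ 2 / 4)) ∂_root_.stdGaussian n :=
          lintegral_mono hle
      _ = 2 * ∫⁻ x, ENNReal.ofReal (Real.exp (distL2 K x ^ 2 / 4)) ∂_root_.stdGaussian n :=
          lintegral_const_mul _ (by fun_prop)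
      _ ≤ 2 * 2 := by gcongr; exact lintegral_exp_distL2_le hK
      _ = 4 := by norm_num
  refine ⟨⟨hc.aestronglyMeasurable, ?_⟩, ?_⟩
  · rw [hasFiniteIntegral_iff_ofReal (ae_of_all _ fun x => distL2_nonneg _ _)]
    exact hint.trans_lt (by simp)
  · rw [integral_eq_lintegral_of_nonneg_ae (ae_of_all _ fun x => distL2_nonneg _ _)
      hc.aestronglyMeasurable]
    exact ENNReal.toReal_le_of_le_ofReal (by norm_num) (by simpa using hint)

/-! ### The two-sided Gaussian tail -/

/-- The probability that a standard Gaussian variable has absolute value at least `x ≥ 0`. -/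
noncomputable def gaussTail (x : ℝ) : ℝ := 1 - 2 * ∫ y in (0 : ℝ)..x, gaussianPDFReal 0 1 y

lemma gaussianPDFReal_std (x : ℝ) :
    gaussianPDFReal 0 1 x = (Real.sqrt (2 * Real.pi))⁻¹ * Real.exp (-x ^ 2 / 2) := by
  simp [gaussianPDFReal]

lemma continuous_gaussianPDFReal_std : Continuous (gaussianPDFReal 0 1) := by
  rw [funext gaussianPDFReal_std]
  fun_prop

lemma hasDerivAt_gaussTail (x : ℝ) : HasDerivAt gaussTail (-(2 * gaussianPDFReal 0 1 x)) x := by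
  have h := intervalIntegral.integral_hasDerivAt_right
    (continuous_gaussianPDFReal_std.intervalIntegrable 0 x)
    (continuous_gaussianPDFReal_std.stronglyMeasurableAtFilter _ _)
    continuous_gaussianPDFReal_std.continuousAt
  exact (h.const_mul 2).const_sub 1

lemma hasDerivAt_gaussianPDFReal_std (x : ℝ) :
    HasDerivAt (gaussianPDFReal 0 1) (-x * gaussianPDFReal 0 1 x) x := by
  rw [gaussianPDFReal_std, funext gaussianPDFReal_std]
  have h : HasDerivAt (fun y : ℝ => -y ^ 2 / 2) (-x) x := by
    exact (((hasDerivAt_pow 2 x).neg).div_const 2).congr_deriv (by norm_num; ring)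
  exact ((h.exp).const_mul (Real.sqrt (2 * Real.pi))⁻¹).congr_deriv (by ring)

lemma continuous_gaussTail : Continuous gaussTail :=
  continuous_iff_continuousAt.2 fun x => (hasDerivAt_gaussTail x).continuousAt

lemma gaussTail_zero : gaussTail 0 = 1 := by simp [gaussTail]

lemma gaussianPDFReal_std_pos (x : ℝ) : 0 < gaussianPDFReal 0 1 x :=
  gaussianPDFReal_pos _ _ _ one_ne_zero

lemma gaussTail_strictAnti : StrictAnti gaussTail :=
  strictAnti_of_hasDerivAt_neg (fun x => hasDerivAt_gaussTail x)
    fun x => by have := gaussianPDFReal_std_pos x; linarith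

lemma tendsto_gaussTail : Tendsto gaussTail atTop (nhds 0) := by
  have h1 := intervalIntegral_tendsto_integral_Ioi (f := gaussianPDFReal 0 1) (μ := volume) 0
    (integrable_gaussianPDFReal 0 1).integrableOn tendsto_id
  have h2 : ∫ x in Set.Ioi (0 : ℝ), gaussianPDFReal 0 1 x = 1 / 2 := by
    rw [funext gaussianPDFReal_std, integral_const_mul]
    have := integral_gaussian_Ioi (1 / 2)
    rw [show (fun x : ℝ => Real.exp (-x ^ 2 / 2)) = fun x : ℝ => Real.exp (-(1 / 2) * x ^ 2) by
      ext x; ring_nf, this]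
    rw [show Real.pi / (1 / 2) = 2 * Real.pi by ring]
    have : 0 < Real.sqrt (2 * Real.pi) := by positivity
    field_simp
  rw [h2] at h1
  have := (h1.const_mul 2).const_sub 1
  norm_num at this
  exact this

lemma gaussTail_pos (x : ℝ) : 0 < gaussTail x := by
  have h : gaussTail (x + 1) < gaussTail x := gaussTail_strictAnti (by linarith)
  exact lt_of_le_of_lt (gaussTail_strictAnti.antitone.le_of_tendsto tendsto_gaussTail _) h

lemma gaussianReal_le_abs {x : ℝ} (hx : 0 ≤ x) :
    gaussianReal 0 1 {y | x ≤ |y|} = ENNReal.ofReal (gaussTail x) := by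
  have hm : MeasurableSet {y : ℝ | x ≤ |y|} := measurableSet_le measurable_const (by fun_prop)
  have hcompl : {y : ℝ | x ≤ |y|}ᶜ = Set.Ioo (-x) x := by
    ext y; simp [abs_lt]
  have h1 : (gaussianReal 0 1).real {y : ℝ | x ≤ |y|} = gaussTail x := by
    have h2 := probReal_compl_eq_one_sub (μ := gaussianReal 0 1) hm
    have h3 : (gaussianReal 0 1).real (Set.Ioo (-x) x) = 2 * ∫ y in (0 : ℝ)..x, gaussianPDFReal 0 1 y := by
      rw [Measure.real, gaussianReal_apply_eq_integral _ one_ne_zero, ENNReal.toReal_ofReal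
        (integral_nonneg fun y => gaussianPDFReal_nonneg _ _ _), ← integral_Ioc_eq_integral_Ioo,
        ← intervalIntegral.integral_of_le (by linarith)]
      have hint := fun a b => continuous_gaussianPDFReal_std.intervalIntegrable (μ := volume) a b
      rw [← intervalIntegral.integral_add_adjacent_intervals (hint (-x) 0) (hint 0 x), two_mul]
      congr 1
      have := intervalIntegral.integral_comp_neg (a := 0) (b := x) (gaussianPDFReal 0 1)
      rw [neg_zero] at this
      rw [← this]
      simp [gaussianPDFReal_std]
    rw [hcompl, h3] at h2
    unfold gaussTail
    linarith
  rw [← h1, Measure.real, ENNReal.ofReal_toReal (measure_ne_top _ _)]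

lemma gaussTail_le_mills {x : ℝ} (hx : 0 ≤ x) :
    gaussTail x ≤ 4 * gaussianPDFReal 0 1 x / (1 + x) := by
  set D : ℝ → ℝ := fun x => 4 * gaussianPDFReal 0 1 x / (1 + x) - gaussTail x
  have hD : ∀ y ∈ Set.Ici (0 : ℝ), HasDerivAt D
      ((4 * (-y * gaussianPDFReal 0 1 y) * (1 + y) - 4 * gaussianPDFReal 0 1 y * 1) / (1 + y) ^ 2 -
        -(2 * gaussianPDFReal 0 1 y)) y := by
    intro y hy
    have hy' : 1 + y ≠ 0 := by have : 0 ≤ y := hy; positivity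
    exact (((hasDerivAt_gaussianPDFReal_std y).const_mul 4).div
      ((hasDerivAt_id y).const_add 1) hy').sub (hasDerivAt_gaussTail y)
  have hanti : AntitoneOn D (Set.Ici 0) := by
    refine antitoneOn_of_deriv_nonpos (convex_Ici 0)
      (fun y hy => (hD y hy).continuousAt.continuousWithinAt)
      (fun y hy => (hD y (interior_subset hy)).differentiableAt.differentiableWithinAt) ?_
    intro y hy
    have hy0 : (0 : ℝ) ≤ y := interior_subset hy
    rw [(hD y (interior_subset hy)).deriv, sub_neg_eq_add, div_add' _ _ _ (by positivity)]
    refine div_nonpos_of_nonpos_of_nonneg ?_ (by positivity)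
    have : 0 < gaussianPDFReal 0 1 y := gaussianPDFReal_std_pos y
    have h3 : (4 * (-y * gaussianPDFReal 0 1 y) * (1 + y) - 4 * gaussianPDFReal 0 1 y * 1) +
        2 * gaussianPDFReal 0 1 y * (1 + y) ^ 2 = -(2 * gaussianPDFReal 0 1 y * (1 + y ^ 2)) := by ring
    rw [h3]
    have : 0 ≤ 2 * gaussianPDFReal 0 1 y * (1 + y ^ 2) := by positivity
    linarith
  have hlim : Tendsto (fun y => - gaussTail y) atTop (nhds 0) := by
    simpa using tendsto_gaussTail.neg
  have : 0 ≤ D x := by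
    refine le_of_tendsto hlim ?_
    filter_upwards [eventually_ge_atTop x] with y hy
    have h1 := hanti (show x ∈ Set.Ici 0 from hx) (show y ∈ Set.Ici 0 from hx.trans hy) hy
    refine le_trans ?_ h1
    have : 0 ≤ 4 * gaussianPDFReal 0 1 y / (1 + y) := by
      have := gaussianPDFReal_nonneg 0 1 y
      have := hx.trans hy
      positivity
    simp only [D]; linarith
  simp only [D] at this
  linarith

/-- Quantitative decay of the Gaussian tail. -/
lemma gaussTail_add_le {x d : ℝ} (hx : 0 ≤ x) (hd : 0 ≤ d) :
    gaussTail (x + d) ≤ gaussTail x * Real.exp (-((d + x * d + d ^ 2 / 2) / 2)) := by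
  set G : ℝ → ℝ := fun x => gaussTail x * Real.exp ((x + x ^ 2 / 2) / 2)
  have hG : ∀ y, HasDerivAt G (-(2 * gaussianPDFReal 0 1 y) * Real.exp ((y + y ^ 2 / 2) / 2) +
      gaussTail y * (Real.exp ((y + y ^ 2 / 2) / 2) * ((1 + y) / 2))) y := by
    intro y
    have h : HasDerivAt (fun y : ℝ => (y + y ^ 2 / 2) / 2) ((1 + y) / 2) y :=
      (((hasDerivAt_id y).add ((hasDerivAt_pow 2 y).div_const 2)).div_const 2).congr_deriv
        (by norm_num)
    exact (hasDerivAt_gaussTail y).mul h.exp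
  have hanti : AntitoneOn G (Set.Ici 0) := by
    refine antitoneOn_of_deriv_nonpos (convex_Ici 0)
      (fun y _ => (hG y).continuousAt.continuousWithinAt)
      (fun y _ => (hG y).differentiableAt.differentiableWithinAt) ?_
    intro y hy
    have hy0 : (0 : ℝ) ≤ y := interior_subset hy
    rw [(hG y).deriv]
    have h1 := gaussTail_le_mills hy0
    rw [le_div_iff₀ (by positivity)] at h1
    have h2 := Real.exp_pos ((y + y ^ 2 / 2) / 2)
    nlinarith
  have h1 := hanti (show x ∈ Set.Ici 0 from hx) (show x + d ∈ Set.Ici 0 from add_nonneg hx hd)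
    (by linarith)
  simp only [G] at h1
  rw [← le_div_iff₀ (Real.exp_pos _), mul_div_assoc, ← Real.exp_sub] at h1
  refine h1.trans_eq ?_
  congr 2; ring

lemma gaussTail_le_exp {x : ℝ} (hx : 0 ≤ x) : gaussTail x ≤ 2 * Real.exp (-x ^ 2 / 2) := by
  refine (gaussTail_le_mills hx).trans ?_
  rw [gaussianPDFReal_std, div_le_iff₀ (by positivity), ← mul_assoc]
  have h1 : 4 * (Real.sqrt (2 * Real.pi))⁻¹ ≤ 2 := by
    have : 2 ≤ Real.sqrt (2 * Real.pi) := by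
      apply Real.le_sqrt_of_sq_le
      nlinarith [Real.pi_gt_three]
    have := inv_anti₀ (by norm_num) this
    linarith
  have h2 := Real.exp_pos (-x ^ 2 / 2)
  nlinarith [mul_le_mul_of_nonneg_right h1 h2.le, mul_nonneg h2.le hx]

lemma exp_le_gaussTail {x : ℝ} (hx : 0 ≤ x) :
    1 / 2 * Real.exp (-(x + 1) ^ 2 / 2) ≤ gaussTail x := by
  have h1 : ∀ y ∈ Set.Icc 0 (x + 1), gaussianPDFReal 0 1 (x + 1) ≤ gaussianPDFReal 0 1 y := by
    intro y hy
    simp only [gaussianPDFReal_std]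
    have := hy.1; have := hy.2
    gcongr
  have h2 : ∃ c ∈ Set.Ioo x (x + 1), -(2 * gaussianPDFReal 0 1 c) =
      (gaussTail (x + 1) - gaussTail x) / (x + 1 - x) :=
    exists_hasDerivAt_eq_slope gaussTail _ (by linarith) continuous_gaussTail.continuousOn
      fun y _ => hasDerivAt_gaussTail y
  obtain ⟨c, hc, hc2⟩ := h2
  have h3 := h1 c ⟨hx.trans hc.1.le, hc.2.le⟩
  have h4 := gaussTail_pos (x + 1)
  rw [add_sub_cancel_left, div_one] at hc2
  have h5 : 1 / 2 * Real.exp (-(x + 1) ^ 2 / 2) ≤ 2 * gaussianPDFReal 0 1 (x + 1) := by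
    rw [gaussianPDFReal_std, ← mul_assoc]
    gcongr
    have : Real.sqrt (2 * Real.pi) ≤ 4 := by
      apply Real.sqrt_le_iff.2
      constructor <;> nlinarith [Real.pi_le_four]
    have := inv_anti₀ (by positivity) this
    linarith
  linarith

lemma exists_gaussTail_eq {t : ℝ} (ht0 : 0 < t) (ht1 : t ≤ 1) : ∃ x, 0 ≤ x ∧ gaussTail x = t := by
  obtain ⟨b, hb, hb0⟩ := ((tendsto_gaussTail.eventually_lt_const ht0).and
    (eventually_ge_atTop 0)).exists
  obtain ⟨x, hx, hxt⟩ := intermediate_value_Icc' hb0 continuous_gaussTail.continuousOn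
    (show t ∈ Set.Icc (gaussTail b) (gaussTail 0) from ⟨hb.le, by rwa [gaussTail_zero]⟩)
  exact ⟨x, hx.1, hxt⟩

lemma exists_gaussQuantile (n : ℕ) (i : Fin n) :
    ∃ x, 0 ≤ x ∧ gaussTail x = ((i : ℝ) + 1) / n := by
  have hn : (0 : ℝ) < n := by exact_mod_cast i.pos
  refine exists_gaussTail_eq (by positivity) ?_
  rw [div_le_one hn]
  exact_mod_cast i.isLt

/-- The deterministic vector of quantiles of the absolute value of a standard Gaussian. -/
noncomputable def gaussQuantile (n : ℕ) (i : Fin n) : ℝ := (exists_gaussQuantile n i).choose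

lemma gaussQuantile_nonneg {n : ℕ} (i : Fin n) : 0 ≤ gaussQuantile n i :=
  (exists_gaussQuantile n i).choose_spec.1

lemma gaussTail_gaussQuantile {n : ℕ} (i : Fin n) :
    gaussTail (gaussQuantile n i) = ((i : ℝ) + 1) / n :=
  (exists_gaussQuantile n i).choose_spec.2

lemma natCast_mul_gaussTail_gaussQuantile {n : ℕ} (i : Fin n) :
    n * gaussTail (gaussQuantile n i) = (i : ℝ) + 1 := by
  have hn : (0 : ℝ) < n := by exact_mod_cast i.pos
  rw [gaussTail_gaussQuantile]; field_simp

lemma gaussQuantile_antitone (n : ℕ) : Antitone (gaussQuantile n) := by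
  intro i j hij
  by_contra! hlt
  have := gaussTail_strictAnti hlt
  rw [gaussTail_gaussQuantile, gaussTail_gaussQuantile] at this
  have h2 : (i : ℝ) ≤ j := by exact_mod_cast hij
  have : ((i : ℝ) + 1) / n ≤ ((j : ℝ) + 1) / n := by gcongr
  linarith

/-! ### Order statistics -/

section OrderStatistics

variable {n : ℕ}

/-- The number of coordinates of absolute value at least `x`. -/
noncomputable def absCount (x : ℝ) (h : Fin n → ℝ) : ℕ :=
  (Finset.univ.filter fun i => x ≤ |h i|).card

lemma lt_absCount_of_le {h : Fin n → ℝ} {σ : Equiv.Perm (Fin n)}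
    (hσ : Antitone fun i => |h (σ i)|) {x : ℝ} {i : Fin n} (hx : x ≤ |h (σ i)|) :
    (i : ℕ) + 1 ≤ absCount x h := by
  rw [← Fin.card_Iic i]
  refine Finset.card_le_card_of_injOn σ (fun j hj => ?_) σ.injective.injOn
  have hj' : j ≤ i := by simpa using hj
  simpa using hx.trans (hσ hj')

lemma absCount_le_of_lt {h : Fin n → ℝ} {σ : Equiv.Perm (Fin n)}
    (hσ : Antitone fun i => |h (σ i)|) {x : ℝ} {i : Fin n} (hx : |h (σ i)| < x) :
    absCount x h ≤ i := by
  rw [← Fin.card_Iio i]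
  refine Finset.card_le_card_of_injOn σ.symm (fun j hj => ?_) σ.symm.injective.injOn
  have hj' : x ≤ |h j| := by simpa using hj
  simp only [Finset.coe_Iio, Set.mem_Iio]
  by_contra! hle
  have := hσ hle
  simp only [Equiv.apply_symm_apply] at this
  linarith

lemma measurable_absCount (x : ℝ) : Measurable fun h : Fin n → ℝ => (absCount x h : ℝ) := by
  have : (fun h : Fin n → ℝ => (absCount x h : ℝ)) =
      fun h => ∑ i, (Set.indicator {y : ℝ | x ≤ |y|} 1 (h i) : ℝ) := by
    ext h
    rw [absCount, Finset.card_filter]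
    push_cast
    refine Finset.sum_congr rfl fun i _ => ?_
    by_cases hi : x ≤ |h i| <;> simp [hi]
  rw [this]
  have hm : MeasurableSet {y : ℝ | x ≤ |y|} := measurableSet_le measurable_const (by fun_prop)
  exact Finset.measurable_sum _ fun i _ => (measurable_one.indicator hm).comp (measurable_pi_apply i)

lemma integrable_exp_mul_absCount (x θ : ℝ) :
    Integrable (fun h : Fin n → ℝ => Real.exp (θ * absCount x h)) (_root_.stdGaussian n) := by
  refine Integrable.of_bound (C := Real.exp (|θ| * n))
    (((measurable_absCount x).const_mul θ).exp).aestronglyMeasurable (ae_of_all _ fun h => ?_)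
  rw [Real.norm_eq_abs, Real.abs_exp, Real.exp_le_exp]
  have h1 : (absCount x h : ℝ) ≤ n := by
    exact_mod_cast (Finset.card_le_univ _).trans_eq (Fintype.card_fin n)
  have h2 : (0 : ℝ) ≤ absCount x h := Nat.cast_nonneg _
  calc θ * absCount x h ≤ |θ| * absCount x h := by gcongr; exact le_abs_self _
    _ ≤ _ := by gcongr

lemma mgf_absCount_le {x : ℝ} (hx : 0 ≤ x) (θ : ℝ) :
    mgf (fun h : Fin n → ℝ => (absCount x h : ℝ)) (_root_.stdGaussian n) θ ≤
      Real.exp (n * gaussTail x * (Real.exp θ - 1)) := by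
  set S : Set ℝ := {y : ℝ | x ≤ |y|} with hS
  have hm : MeasurableSet S := measurableSet_le measurable_const (by fun_prop)
  have e : ∀ h : Fin n → ℝ, Real.exp (θ * absCount x h) =
      ∏ i, (S.indicator (fun _ => Real.exp θ - 1) (h i) + 1) := by
    intro h
    rw [mul_comm, Real.exp_nat_mul, absCount, ← Finset.prod_const, Finset.prod_filter]
    refine Finset.prod_congr rfl fun i _ => ?_
    by_cases hi : x ≤ |h i|
    · simp [hi, hS]
    · simp [hi, hS]
  have hreal : (gaussianReal 0 1).real S = gaussTail x := by
    rw [Measure.real, gaussianReal_le_abs hx, ENNReal.toReal_ofReal (gaussTail_pos x).le]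
  have hone : ∫ y, (S.indicator (fun _ => Real.exp θ - 1) y + 1) ∂gaussianReal 0 1 =
      gaussTail x * (Real.exp θ - 1) + 1 := by
    rw [integral_add ((integrable_const _).indicator hm) (integrable_const _),
      integral_indicator_const _ hm, hreal]
    simp
  rw [mgf]
  simp only [e]
  unfold _root_.stdGaussian
  rw [integral_fintype_prod_eq_prod (fun _ : Fin n => fun y => S.indicator (fun _ => Real.exp θ - 1) y + 1)]
  simp only [hone, Finset.prod_const, Finset.card_univ, Fintype.card_fin]
  rw [mul_assoc, Real.exp_nat_mul]
  refine pow_le_pow_left₀ ?_ (Real.add_one_le_exp _) n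
  have h1 : gaussTail x ≤ 1 := by
    rw [← gaussTail_zero]; exact gaussTail_strictAnti.antitone hx
  have h2 := gaussTail_pos x
  nlinarith [Real.exp_pos θ]

lemma sub_one_add_exp_neg_ge (τ : ℝ) : min (τ ^ 2 / 4) (τ / 2) ≤ τ - 1 + Real.exp (-τ) := by
  have h1 : 1 - τ / 2 ≤ Real.exp (-τ / 2) := by linarith [Real.add_one_le_exp (-τ / 2)]
  by_cases h2 : τ ≤ 2
  · refine (min_le_left _ _).trans ?_
    have h3 : (1 - τ / 2) ^ 2 ≤ Real.exp (-τ / 2) ^ 2 := pow_le_pow_left₀ (by linarith) h1 2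
    rw [← Real.exp_nat_mul] at h3
    rw [show ((2 : ℕ) : ℝ) * (-τ / 2) = -τ by push_cast; ring] at h3
    nlinarith
  · refine (min_le_right _ _).trans ?_
    have := Real.exp_pos (-τ)
    linarith

lemma measure_le_absCount_le {x ρ τ : ℝ} (hx : 0 ≤ x) (hτ : 0 ≤ τ) (hρ : 0 ≤ ρ)
    (h : n * gaussTail x ≤ ρ * Real.exp (-τ)) :
    (_root_.stdGaussian n).real {h | ρ ≤ absCount x h} ≤ Real.exp (-(ρ * min (τ ^ 2 / 4) (τ / 2))) := by
  have h1 := measure_ge_le_exp_mul_mgf (X := fun h : Fin n → ℝ => (absCount x h : ℝ))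
    (μ := _root_.stdGaussian n) ρ hτ (integrable_exp_mul_absCount x τ)
  refine h1.trans ((mul_le_mul_of_nonneg_left (mgf_absCount_le hx τ) (Real.exp_nonneg _)).trans ?_)
  rw [← Real.exp_add, Real.exp_le_exp]
  have h2 := mul_le_mul_of_nonneg_left (sub_one_add_exp_neg_ge τ) hρ
  have h3 : 0 ≤ Real.exp τ - 1 := by linarith [Real.add_one_le_exp τ]
  have h4 := mul_le_mul_of_nonneg_right h h3
  have h5 : Real.exp (-τ) * Real.exp τ = 1 := by rw [← Real.exp_add]; simp
  have h6 : ρ * Real.exp (-τ) * (Real.exp τ - 1) = ρ * (1 - Real.exp (-τ)) := by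
    rw [mul_assoc, mul_sub, h5, mul_one]
  rw [h6] at h4
  linarith

lemma measure_absCount_le_le {x ρ τ : ℝ} (hx : 0 ≤ x) (hτ : 0 ≤ τ) (hρ : 0 ≤ ρ)
    (h : ρ * Real.exp τ ≤ n * gaussTail x) :
    (_root_.stdGaussian n).real {h | absCount x h ≤ ρ} ≤ Real.exp (-(ρ * (τ ^ 2 / 2))) := by
  have h1 := measure_le_le_exp_mul_mgf (X := fun h : Fin n → ℝ => (absCount x h : ℝ))
    (μ := _root_.stdGaussian n) ρ (neg_nonpos.2 hτ) (integrable_exp_mul_absCount x (-τ))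
  refine h1.trans ((mul_le_mul_of_nonneg_left (mgf_absCount_le hx (-τ)) (Real.exp_nonneg _)).trans ?_)
  rw [← Real.exp_add, Real.exp_le_exp]
  have h3 : 0 ≤ 1 - Real.exp (-τ) := by
    have := Real.exp_le_one_iff.2 (neg_nonpos.2 hτ); linarith
  have h4 := mul_le_mul_of_nonneg_right h h3
  have h5 : Real.exp τ * Real.exp (-τ) = 1 := by rw [← Real.exp_add]; simp
  have h6 : ρ * Real.exp τ * (1 - Real.exp (-τ)) = ρ * (Real.exp τ - 1) := by
    rw [mul_assoc, mul_sub, h5, mul_one]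
  rw [h6] at h4
  have h7 := mul_le_mul_of_nonneg_left (Real.quadratic_le_exp_of_nonneg hτ) hρ
  linarith

end OrderStatistics

section Deviations

variable {n : ℕ}

/-- The typical fluctuation of the `i`-th largest absolute value around its quantile. -/
noncomputable def devScale (n : ℕ) (i : Fin n) : ℝ :=
  1 / (Real.sqrt ((i : ℝ) + 1) * (1 + gaussQuantile n i))

lemma devScale_pos (i : Fin n) : 0 < devScale n i := by
  have := gaussQuantile_nonneg i
  unfold devScale; positivity

/-- An event of small probability off which the `i`-th largest absolute value deviates from its
quantile by at most `(k + 1)` typical fluctuations. -/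
def devEvent (i : Fin n) (k : ℕ) : Set (Fin n → ℝ) :=
  {h | (i : ℝ) + 1 ≤ absCount (gaussQuantile n i + k * devScale n i) h} ∪
    {h | k * devScale n i ≤ gaussQuantile n i ∧
      (absCount (gaussQuantile n i - k * devScale n i) h : ℝ) ≤ (i : ℝ) + 1}

lemma measurableSet_devEvent (i : Fin n) (k : ℕ) : MeasurableSet (devEvent i k) := by
  refine (measurableSet_le measurable_const (measurable_absCount _)).union ?_
  exact (MeasurableSet.const _).inter (measurableSet_le (measurable_absCount _) measurable_const)

lemma measure_devEvent_le (i : Fin n) {k : ℕ} (hk : 1 ≤ k) :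
    (_root_.stdGaussian n).real (devEvent i k) ≤ 2 * Real.exp (-(k / 32)) := by
  set x := gaussQuantile n i with hx
  have hx0 : 0 ≤ x := gaussQuantile_nonneg i
  set ρ : ℝ := (i : ℝ) + 1 with hρ
  have hρ1 : 1 ≤ ρ := by simp [hρ]
  set r := Real.sqrt ρ with hr
  have hr1 : 1 ≤ r := Real.one_le_sqrt.2 hρ1
  have hr2 : r ^ 2 = ρ := Real.sq_sqrt (by linarith)
  have hk1 : (1 : ℝ) ≤ k := by exact_mod_cast hk
  have hδ : devScale n i = 1 / (r * (1 + x)) := rfl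
  set d := k * devScale n i with hd
  have hd0 : 0 ≤ d := mul_nonneg (Nat.cast_nonneg _) (devScale_pos i).le
  have hdr : (1 + x) * d = k / r := by
    rw [hd, hδ]; field_simp
  have hnp : n * gaussTail x = ρ := natCast_mul_gaussTail_gaussQuantile i
  have hunion : devEvent i k = {h | ρ ≤ absCount (x + d) h} ∪
      {h | d ≤ x ∧ (absCount (x - d) h : ℝ) ≤ ρ} := rfl
  rw [hunion]
  clear_value ρ x d
  refine (measureReal_union_le _ _).trans ?_
  rw [two_mul]
  refine add_le_add ?_ ?_
  · refine (measure_le_absCount_le (τ := k / r / 2) (by positivity) (by positivity) (by positivity)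
      ?_).trans ?_
    · rw [← hdr]
      calc n * gaussTail (x + d) ≤ n * (gaussTail x * Real.exp (-((d + x * d + d ^ 2 / 2) / 2))) := by
            gcongr; exact gaussTail_add_le hx0 hd0
        _ = ρ * Real.exp (-((d + x * d + d ^ 2 / 2) / 2)) := by rw [← mul_assoc, hnp]
        _ ≤ _ := by
            gcongr
            nlinarith [sq_nonneg d]
    · rw [Real.exp_le_exp, neg_le_neg_iff, mul_min_of_nonneg _ _ (by positivity), ← hr2]
      refine le_min ?_ ?_
      · rw [show r ^ 2 * ((k / r / 2) ^ 2 / 4) = (k : ℝ) ^ 2 / 16 by field_simp; norm_num]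
        nlinarith
      · rw [show r ^ 2 * (k / r / 2 / 2) = (k : ℝ) * r / 4 by field_simp; norm_num]
        nlinarith
  · by_cases hdx : d ≤ x
    · simp only [hdx, true_and]
      refine (measure_absCount_le_le (τ := k / r / 4) (by linarith) (by positivity) (by positivity)
        ?_).trans ?_
      · have h1 := gaussTail_add_le (x := x - d) (by linarith) hd0
        rw [sub_add_cancel, Real.exp_neg, ← div_eq_mul_inv, le_div_iff₀ (Real.exp_pos _)] at h1
        refine le_trans ?_ (mul_le_mul_of_nonneg_left h1 (Nat.cast_nonneg n))
        rw [← mul_assoc, hnp, ← hdr]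
        refine mul_le_mul_of_nonneg_left (Real.exp_le_exp.2 ?_) (by linarith)
        nlinarith
      · rw [Real.exp_le_exp, neg_le_neg_iff, ← hr2]
        rw [show r ^ 2 * ((k / r / 4) ^ 2 / 2) = (k : ℝ) ^ 2 / 32 by field_simp; norm_num]
        nlinarith
    · simp [hdx, Real.exp_nonneg]

/-- A random variable with bounded mean dominating the fourth power of the normalized deviation. -/
noncomputable def devSum (i : Fin n) (h : Fin n → ℝ) : ℝ≥0∞ :=
  1 + ∑' k : ℕ, ENNReal.ofReal (((k : ℝ) + 2) ^ 4) * (devEvent i (k + 1)).indicator 1 h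

lemma measurable_devSum (i : Fin n) : Measurable (devSum i) := by
  unfold devSum
  have h : ∀ k : ℕ, Measurable fun h : Fin n → ℝ =>
      ENNReal.ofReal (((k : ℝ) + 2) ^ 4) * (devEvent i (k + 1)).indicator 1 h := fun k =>
    (measurable_one.indicator (measurableSet_devEvent i _)).const_mul _
  exact measurable_const.add (Measurable.tsum h)

lemma ofReal_deviation_pow_le {h : Fin n → ℝ} {σ : Equiv.Perm (Fin n)}
    (hσ : Antitone fun i => |h (σ i)|) (i : Fin n) :
    ENNReal.ofReal (((|h (σ i)| - gaussQuantile n i) / devScale n i) ^ 4) ≤ devSum i h := by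
  set δ := devScale n i with hδ
  have hδ0 : 0 < δ := devScale_pos i
  set x := gaussQuantile n i with hx
  set t := |(|h (σ i)| - x) / δ| with ht
  have ht4 : ((|h (σ i)| - x) / δ) ^ 4 = t ^ 4 := by
    rw [ht, Even.pow_abs (by decide)]
  rw [ht4]
  unfold devSum
  by_cases ht1 : t ≤ 1
  · refine le_trans ?_ le_self_add
    rw [← ENNReal.ofReal_one]
    exact ENNReal.ofReal_le_ofReal (pow_le_one₀ (abs_nonneg _) ht1)
  · push Not at ht1
    obtain ⟨k, hk⟩ : ∃ k : ℕ, ⌈t⌉₊ = k + 2 :=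
      ⟨⌈t⌉₊ - 2, by have : 1 < ⌈t⌉₊ := Nat.lt_ceil.2 (by exact_mod_cast ht1); omega⟩
    have hkt : ((k + 1 : ℕ) : ℝ) < t := Nat.lt_ceil.1 (by omega)
    have htk : t ≤ (k : ℝ) + 2 := by
      have := Nat.le_ceil t
      rw [hk] at this
      exact_mod_cast this
    have hmem : h ∈ devEvent i (k + 1) := by
      rw [ht, abs_div, abs_of_pos hδ0, lt_div_iff₀ hδ0, lt_abs] at hkt
      rcases hkt with hkt | hkt
      · left
        have := lt_absCount_of_le hσ (i := i) (x := x + ((k + 1 : ℕ) : ℝ) * δ) (by linarith)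
        simp only [Set.mem_ofPred_eq]
        exact_mod_cast this
      · right
        have h0 := abs_nonneg (h (σ i))
        refine ⟨by linarith, ?_⟩
        have := absCount_le_of_lt hσ (i := i) (x := x - ((k + 1 : ℕ) : ℝ) * δ) (by linarith)
        have h2 : (absCount (x - ((k + 1 : ℕ) : ℝ) * δ) h : ℝ) ≤ (i : ℕ) := by exact_mod_cast this
        linarith
    refine le_trans ?_ le_add_self
    refine le_trans ?_ (ENNReal.le_tsum k)
    rw [Set.indicator_of_mem hmem, Pi.one_apply, mul_one]
    refine ENNReal.ofReal_le_ofReal (pow_le_pow_left₀ (abs_nonneg _) htk 4)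

/-- A uniform bound for the mean of `devSum`. -/
noncomputable def devConst : ℝ :=
  1 + ∑' k : ℕ, ((k : ℝ) + 2) ^ 4 * (2 * Real.exp (-(((k + 1 : ℕ) : ℝ) / 32)))

lemma summable_devConst :
    Summable fun k : ℕ => ((k : ℝ) + 2) ^ 4 * (2 * Real.exp (-(((k + 1 : ℕ) : ℝ) / 32))) := by
  have h := (summable_nat_add_iff 2).2
    (Real.summable_pow_mul_exp_neg_nat_mul 4 (r := 1 / 32) (by norm_num))
  refine (h.mul_left (2 * Real.exp (1 / 32))).congr fun k => ?_
  have e : Real.exp (-(((k + 1 : ℕ) : ℝ) / 32)) =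
      Real.exp (1 / 32) * Real.exp (-(1 / 32) * ((k + 2 : ℕ) : ℝ)) := by
    rw [← Real.exp_add]; congr 1; push_cast; ring
  rw [e]; push_cast; ring

lemma lintegral_devSum_le (i : Fin n) :
    ∫⁻ h, devSum i h ∂_root_.stdGaussian n ≤ ENNReal.ofReal devConst := by
  unfold devSum
  rw [lintegral_add_left measurable_const, lintegral_tsum fun k =>
    ((measurable_one.indicator (measurableSet_devEvent i _)).const_mul _).aemeasurable]
  unfold devConst
  have hnn : ∀ k : ℕ, 0 ≤ ((k : ℝ) + 2) ^ 4 * (2 * Real.exp (-(((k + 1 : ℕ) : ℝ) / 32))) :=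
    fun k => by positivity
  rw [ENNReal.ofReal_add zero_le_one (tsum_nonneg hnn), ENNReal.ofReal_tsum_of_nonneg hnn
    summable_devConst]
  refine add_le_add (by simp) (ENNReal.tsum_le_tsum fun k => ?_)
  rw [lintegral_const_mul _ (measurable_one.indicator (measurableSet_devEvent i _)),
    lintegral_indicator_one (measurableSet_devEvent i _), ENNReal.ofReal_mul (by positivity)]
  gcongr
  rw [← ENNReal.ofReal_toReal (measure_ne_top (_root_.stdGaussian n) (devEvent i (k + 1)))]
  exact ENNReal.ofReal_le_ofReal (measure_devEvent_le i (by omega))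

lemma one_le_devConst : 1 ≤ devConst := by
  unfold devConst
  have : 0 ≤ ∑' k : ℕ, ((k : ℝ) + 2) ^ 4 * (2 * Real.exp (-(((k + 1 : ℕ) : ℝ) / 32))) :=
    tsum_nonneg fun k => by positivity
  linarith

end Deviations

section Windows

variable {n : ℕ}

/-- The index `j` of the window `[j ^ 3, (j + 1) ^ 3)` containing the `i`-th quantile. -/
noncomputable def winIdx (i : Fin n) : ℕ := ⌊gaussQuantile n i ^ (1 / 3 : ℝ)⌋₊

lemma rpow_third_pow_three {x : ℝ} (hx : 0 ≤ x) : (x ^ (1 / 3 : ℝ)) ^ 3 = x := by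
  rw [← Real.rpow_natCast, ← Real.rpow_mul hx]; norm_num

lemma winIdx_pow_le (i : Fin n) : (winIdx i : ℝ) ^ 3 ≤ gaussQuantile n i := by
  have h0 := gaussQuantile_nonneg i
  calc (winIdx i : ℝ) ^ 3 ≤ (gaussQuantile n i ^ (1 / 3 : ℝ)) ^ 3 := by
        gcongr; exact Nat.floor_le (Real.rpow_nonneg h0 _)
    _ = _ := rpow_third_pow_three h0

lemma lt_winIdx_pow (i : Fin n) : gaussQuantile n i < ((winIdx i : ℝ) + 1) ^ 3 := by
  have h0 := gaussQuantile_nonneg i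
  calc gaussQuantile n i = (gaussQuantile n i ^ (1 / 3 : ℝ)) ^ 3 := (rpow_third_pow_three h0).symm
    _ < _ := by
      have := Real.rpow_nonneg h0 (1 / 3)
      gcongr; exact Nat.lt_floor_add_one _

/-- The set of indices whose quantile lies in the `j`-th window. -/
noncomputable def window (n j : ℕ) : Finset (Fin n) := Finset.univ.filter fun i => winIdx i = j

lemma mem_window {j : ℕ} {i : Fin n} : i ∈ window n j ↔ winIdx i = j := by simp [window]

lemma inv_succ_le_log (k : ℕ) : 1 / ((k : ℝ) + 1) ≤ 2 * (Real.log ((k : ℝ) + 2) - Real.log ((k : ℝ) + 1)) := by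
  rw [← Real.log_div (by positivity) (by positivity)]
  have h := Real.one_sub_inv_le_log_of_pos (x := ((k : ℝ) + 2) / ((k : ℝ) + 1)) (by positivity)
  have h2 : 1 / ((k : ℝ) + 1) ≤ 2 * (1 - (((k : ℝ) + 2) / ((k : ℝ) + 1))⁻¹) := by
    rw [inv_div, one_sub_div (by positivity), mul_div_assoc', div_le_div_iff₀ (by positivity) (by positivity)]
    have : (0 : ℝ) ≤ k := Nat.cast_nonneg k
    nlinarith
  linarith

lemma sum_inv_rank_le {W : Finset (Fin n)} {R : ℝ} (hR : 1 ≤ R)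
    (h : ∀ a ∈ W, ∀ b ∈ W, (b : ℝ) + 1 ≤ R * ((a : ℝ) + 1)) :
    ∑ i ∈ W, 1 / ((i : ℝ) + 1) ≤ 2 * Real.log (2 * R) := by
  rcases W.eq_empty_or_nonempty with rfl | hW
  · simpa using Real.log_nonneg (by linarith)
  obtain ⟨a, ha, hamin⟩ := W.exists_min_image id hW
  obtain ⟨b, hb, hbmax⟩ := W.exists_max_image id hW
  simp only [id] at hamin hbmax
  have hab : (a : ℕ) ≤ b := hamin b hb
  have hlog : ∀ k l : ℕ, k ≤ l → ∑ i ∈ Finset.Ico k (l + 1), 1 / ((i : ℝ) + 1) ≤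
      2 * (Real.log ((l : ℝ) + 2) - Real.log ((k : ℝ) + 1)) := by
    intro k l hkl
    induction l, hkl using Nat.le_induction with
    | base => simpa using inv_succ_le_log k
    | succ l hkl ih =>
      rw [Finset.sum_Ico_succ_top (by omega)]
      have := inv_succ_le_log (l + 1)
      push_cast at this ⊢
      rw [show (l : ℝ) + 1 + 1 = l + 2 by ring] at this ⊢
      linarith
  calc ∑ i ∈ W, 1 / ((i : ℝ) + 1) = ∑ k ∈ W.map Fin.valEmbedding, 1 / ((k : ℝ) + 1) := by
        rw [Finset.sum_map]; rfl
    _ ≤ ∑ k ∈ Finset.Ico (a : ℕ) (b + 1), 1 / ((k : ℝ) + 1) := by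
        refine Finset.sum_le_sum_of_subset_of_nonneg (fun k hk => ?_) fun _ _ _ => by positivity
        obtain ⟨i, hi, rfl⟩ := Finset.mem_map.1 hk
        have h1 : (a : ℕ) ≤ i := hamin i hi
        have h2 : (i : ℕ) ≤ b := hbmax i hi
        simp only [Fin.valEmbedding_apply, Finset.mem_Ico]
        omega
    _ ≤ 2 * (Real.log ((b : ℝ) + 2) - Real.log ((a : ℝ) + 1)) := hlog _ _ hab
    _ ≤ _ := by
        have h1 := h a ha b hb
        rw [← Real.log_div (by positivity) (by positivity)]
        gcongr
        rw [div_le_iff₀ (by positivity)]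
        have : (0 : ℝ) ≤ (b : ℕ) := Nat.cast_nonneg _
        linarith

lemma sum_window_inv_rank_le (n j : ℕ) :
    ∑ i ∈ window n j, 1 / ((i : ℝ) + 1) ≤ 12 * ((j : ℝ) + 1) ^ 5 := by
  have hj : (0 : ℝ) ≤ j := Nat.cast_nonneg j
  refine (sum_inv_rank_le (R := 4 * Real.exp (3 * ((j : ℝ) + 1) ^ 5)) ?_ ?_).trans ?_
  · have : 1 ≤ Real.exp (3 * ((j : ℝ) + 1) ^ 5) := Real.one_le_exp (by positivity)
    linarith
  · intro a ha b hb
    rw [mem_window] at ha hb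
    rw [← natCast_mul_gaussTail_gaussQuantile a, ← natCast_mul_gaussTail_gaussQuantile b,
      mul_left_comm]
    refine mul_le_mul_of_nonneg_left ?_ (Nat.cast_nonneg n)
    have h1 := exp_le_gaussTail (gaussQuantile_nonneg a)
    have h2 := gaussTail_le_exp (gaussQuantile_nonneg b)
    have ha3 := lt_winIdx_pow a
    have hb3 := winIdx_pow_le b
    rw [ha] at ha3
    rw [hb] at hb3
    have ha0 := gaussQuantile_nonneg a
    calc _ ≤ _ := h2
      _ ≤ 4 * Real.exp (3 * ((j : ℝ) + 1) ^ 5) *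
          (1 / 2 * Real.exp (-(gaussQuantile n a + 1) ^ 2 / 2)) := by
        rw [show ∀ x y : ℝ, 4 * x * (1 / 2 * y) = 2 * (x * y) by intros; ring, ← Real.exp_add]
        gcongr
        have e1 : (gaussQuantile n a + 1) ^ 2 ≤ (((j : ℝ) + 1) ^ 3 + 1) ^ 2 := by gcongr
        have e2 : ((j : ℝ) ^ 3) ^ 2 ≤ gaussQuantile n b ^ 2 := by gcongr
        have e3 : (((j : ℝ) + 1) ^ 3 + 1) ^ 2 - ((j : ℝ) ^ 3) ^ 2 ≤ 6 * ((j : ℝ) + 1) ^ 5 := by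
          have p2 : 0 ≤ (j : ℝ) ^ 2 := by positivity
          have p3 : 0 ≤ (j : ℝ) ^ 3 := by positivity
          have p4 : 0 ≤ (j : ℝ) ^ 4 := by positivity
          nlinarith
        linarith
      _ ≤ _ := by gcongr
  · rw [← mul_assoc, Real.log_mul (by norm_num) (Real.exp_pos _).ne', Real.log_exp]
    have h8 : Real.log (2 * 4) ≤ 3 := by
      rw [show (2 : ℝ) * 4 = 2 ^ 3 by norm_num, Real.log_pow]
      have := Real.log_two_lt_d9
      push_cast; linarith
    have : 1 ≤ ((j : ℝ) + 1) ^ 5 := one_le_pow₀ (by linarith)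
    linarith

/-- The total squared fluctuation scale in a window. -/
noncomputable def windowScale (n j : ℕ) : ℝ := ∑ i ∈ window n j, devScale n i ^ 2

lemma windowScale_nonneg (n j : ℕ) : 0 ≤ windowScale n j :=
  Finset.sum_nonneg fun _ _ => sq_nonneg _

lemma windowScale_le (n j : ℕ) : windowScale n j ≤ 192 * (1 / ((j : ℝ) + 1)) := by
  have hj : (0 : ℝ) ≤ j := Nat.cast_nonneg j
  have h1 : windowScale n j ≤ (∑ i ∈ window n j, 1 / ((i : ℝ) + 1)) * (16 / ((j : ℝ) + 1) ^ 6) := by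
    rw [Finset.sum_mul]
    refine Finset.sum_le_sum fun i hi => ?_
    rw [mem_window] at hi
    have h2 := winIdx_pow_le i
    rw [hi] at h2
    have h3 := gaussQuantile_nonneg i
    rw [devScale, div_pow, mul_pow, Real.sq_sqrt (by positivity), one_pow, div_mul_div_comm, one_mul,
      div_le_div_iff₀ (by positivity) (by positivity), one_mul]
    have h4 : ((j : ℝ) + 1) ^ 3 ≤ 4 * (1 + gaussQuantile n i) := by
      nlinarith [mul_nonneg hj (sq_nonneg ((j : ℝ) - 1)), sq_nonneg ((j : ℝ) - 1)]
    have h5 : ((j : ℝ) + 1) ^ 6 ≤ 16 * (1 + gaussQuantile n i) ^ 2 := by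
      calc ((j : ℝ) + 1) ^ 6 = (((j : ℝ) + 1) ^ 3) ^ 2 := by ring
        _ ≤ (4 * (1 + gaussQuantile n i)) ^ 2 := by gcongr
        _ = _ := by ring
    calc ((i : ℝ) + 1) * ((j : ℝ) + 1) ^ 6 ≤ ((i : ℝ) + 1) * (16 * (1 + gaussQuantile n i) ^ 2) := by
          gcongr
      _ = _ := by ring
  refine h1.trans ((mul_le_mul_of_nonneg_right (sum_window_inv_rank_le n j) (by positivity)).trans_eq ?_)
  field_simp
  norm_num

lemma sum_eq_sum_window (f : Fin n → ℝ) :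
    ∑ i, f i = ∑ j ∈ Finset.univ.image (winIdx : Fin n → ℕ), ∑ i ∈ window n j, f i :=
  (Finset.sum_fiberwise_of_maps_to (fun i _ => Finset.mem_image_of_mem _ (Finset.mem_univ i)) f).symm

lemma summable_inv_succ_sq : Summable fun j : ℕ => (1 / ((j : ℝ) + 1)) ^ 2 := by
  have h := (summable_nat_add_iff 1).2 (Real.summable_one_div_nat_pow.2 (one_lt_two))
  refine h.congr fun j => ?_
  push_cast
  rw [div_pow, one_pow]

lemma sum_windowScale_mul_le (n : ℕ) :
    ∑ i : Fin n, windowScale n (winIdx i) * devScale n i ^ 2 ≤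
      192 ^ 2 * ∑' j : ℕ, (1 / ((j : ℝ) + 1)) ^ 2 := by
  rw [sum_eq_sum_window, ← tsum_mul_left]
  have h1 : ∀ j, ∑ i ∈ window n j, windowScale n (winIdx i) * devScale n i ^ 2 = windowScale n j ^ 2 := by
    intro j
    rw [sq, windowScale, Finset.mul_sum]
    refine Finset.sum_congr rfl fun i hi => ?_
    rw [mem_window.1 hi]; rfl
  simp only [h1]
  refine (Finset.sum_le_sum fun j _ => ?_).trans
    ((summable_inv_succ_sq.mul_left _).sum_le_tsum _ fun j _ => by positivity)
  rw [← mul_pow]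
  exact pow_le_pow_left₀ (windowScale_nonneg n j) (windowScale_le n j) 2

/-- A bound for the mean total fluctuation of the order statistics. -/
noncomputable def fluctConst : ℝ := 192 ^ 2 * (∑' j : ℕ, (1 / ((j : ℝ) + 1)) ^ 2) * devConst

lemma fluctConst_pos : 0 < fluctConst := by
  have h : 0 < ∑' j : ℕ, (1 / ((j : ℝ) + 1)) ^ 2 :=
    summable_inv_succ_sq.tsum_pos (fun j => by positivity) 0 (by norm_num)
  have := one_le_devConst
  unfold fluctConst
  positivity

/-- With probability at least one half, the order statistics of the absolute values stay close to
the quantiles, simultaneously in every window. -/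
lemma exists_orderStatistics_close (n : ℕ) : ∃ K : Set (Fin n → ℝ), 1 / 2 ≤ _root_.stdGaussian n K ∧
    ∀ h ∈ K, ∀ σ : Equiv.Perm (Fin n), (Antitone fun i => |h (σ i)|) → ∀ j,
      ∑ i ∈ window n j, (|h (σ i)| - gaussQuantile n i) ^ 2 ≤ Real.sqrt (2 * fluctConst) := by
  set Y : (Fin n → ℝ) → ℝ≥0∞ := fun h =>
    ∑ i, ENNReal.ofReal (windowScale n (winIdx i) * devScale n i ^ 2) * devSum i h with hY
  have hYm : Measurable Y := Finset.measurable_sum _ fun i _ => (measurable_devSum i).const_mul _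
  have hEY : ∫⁻ h, Y h ∂_root_.stdGaussian n ≤ ENNReal.ofReal fluctConst := by
    rw [lintegral_finsetSum _ fun i _ => (measurable_devSum i).const_mul _]
    calc _ ≤ ∑ i, ENNReal.ofReal (windowScale n (winIdx i) * devScale n i ^ 2) * ENNReal.ofReal devConst := by
          refine Finset.sum_le_sum fun i _ => ?_
          rw [lintegral_const_mul _ (measurable_devSum i)]
          gcongr
          exact lintegral_devSum_le i
      _ = ENNReal.ofReal ((∑ i, windowScale n (winIdx i) * devScale n i ^ 2) * devConst) := by
          rw [← Finset.sum_mul, ← ENNReal.ofReal_sum_of_nonneg fun i _ =>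
            mul_nonneg (windowScale_nonneg _ _) (sq_nonneg _), ← ENNReal.ofReal_mul]
          exact Finset.sum_nonneg fun i _ => mul_nonneg (windowScale_nonneg _ _) (sq_nonneg _)
      _ ≤ _ := by
          have := one_le_devConst
          refine ENNReal.ofReal_le_ofReal (mul_le_mul_of_nonneg_right (sum_windowScale_mul_le n) ?_)
          linarith
  refine ⟨{h | Y h < ENNReal.ofReal (2 * fluctConst)}, ?_, ?_⟩
  · have hm : MeasurableSet {h | Y h < ENNReal.ofReal (2 * fluctConst)} :=
      measurableSet_lt hYm measurable_const
    have h1 := mul_meas_ge_le_lintegral₀ hYm.aemeasurable (μ := _root_.stdGaussian n)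
      (ENNReal.ofReal (2 * fluctConst))
    have h2 := h1.trans hEY
    have h0 := fluctConst_pos
    rw [mul_comm, ← ENNReal.le_div_iff_mul_le (by simp [h0]) (by simp), ← ENNReal.ofReal_div_of_pos
      (by linarith), show fluctConst / (2 * fluctConst) = 1 / 2 by field_simp] at h2
    have h3 := prob_compl_eq_one_sub (μ := _root_.stdGaussian n) hm.compl
    rw [compl_compl] at h3
    rw [h3]
    have hc : {h | Y h < ENNReal.ofReal (2 * fluctConst)}ᶜ = {h | ENNReal.ofReal (2 * fluctConst) ≤ Y h} := by
      ext h; simp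
    rw [hc]
    refine ENNReal.le_sub_of_add_le_right (by simp) ?_
    calc _ ≤ 1 / 2 + ENNReal.ofReal (1 / 2) := by gcongr
      _ = 1 := by
        rw [ENNReal.ofReal_div_of_pos two_pos]
        simp [ENNReal.inv_two_add_inv_two]
  · intro h hh σ hσ j
    apply Real.le_sqrt_of_sq_le
    have h1 : (∑ i ∈ window n j, (|h (σ i)| - gaussQuantile n i) ^ 2) ^ 2 ≤
        windowScale n j * ∑ i ∈ window n j,
          devScale n i ^ 2 * ((|h (σ i)| - gaussQuantile n i) / devScale n i) ^ 4 := by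
      refine Finset.sum_sq_le_sum_mul_sum_of_sq_le_mul _ (fun _ _ => sq_nonneg _)
        (fun i _ => by positivity) fun i _ => ?_
      have := devScale_pos i
      refine le_of_eq ?_
      field_simp
    refine h1.trans ?_
    rw [← ENNReal.ofReal_le_ofReal_iff (by have := fluctConst_pos; positivity)]
    refine le_trans ?_ hh.le
    rw [Finset.mul_sum, ENNReal.ofReal_sum_of_nonneg fun i _ => mul_nonneg (windowScale_nonneg _ _)
      (by positivity)]
    refine (Finset.sum_le_sum fun i hi => ?_).trans
      (Finset.sum_le_univ_sum_of_nonneg fun i => zero_le)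
    rw [mem_window.1 hi, ← mul_assoc, ENNReal.ofReal_mul (mul_nonneg (windowScale_nonneg _ _) (sq_nonneg _))]
    gcongr
    exact ofReal_deviation_pow_le hσ i

end Windows

/-! ### Shape of the residual of the projection onto an `ℓ^q` ball -/

section Projection

variable {n : ℕ}

/-- The properties of the unit residual of a nonnegative vector projected onto an `ℓ^q` ball. -/
structure IsProfile (C : Set (Fin n → ℝ)) (y u : Fin n → ℝ) : Prop where
  nonneg : ∀ i, 0 ≤ u i
  sum_sq_le : ∑ i, u i ^ 2 ≤ 1
  sub_le : ∀ y', distL2 C y - distL2 C y' ≤ ∑ i, u i * (y i - y' i)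
  mono : ∀ i l, y i ≤ y l → u i ≤ u l
  mid : ∀ a b l, (y a + y b) / 2 ≤ y l → u a * u b ≤ u l ^ 2

lemma exists_isProfile_of_residual {C : Set (Fin n → ℝ)} {y w : Fin n → ℝ} (hw : w ∈ C)
    (hwy : ∀ i, w i ≤ y i) (hcone : ∀ v ∈ C, ∑ i, (y i - w i) * (v i - w i) ≤ 0)
    (hmono : ∀ i l, y i ≤ y l → y i - w i ≤ y l - w l)
    (hmid : ∀ a b l, (y a + y b) / 2 ≤ y l → (y a - w a) * (y b - w b) ≤ (y l - w l) ^ 2) :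
    ∃ u, IsProfile C y u := by
  set R := l2norm (y - w) with hR
  have hdist : distL2 C y ≤ R := distL2_le hw y
  rcases (l2norm_nonneg (y - w)).eq_or_lt with h0 | hpos
  · refine ⟨0, fun _ => le_rfl, by simp, fun y' => ?_, fun _ _ _ => le_rfl, fun _ _ _ _ => by simp⟩
    have := distL2_nonneg C y'
    simp only [Pi.zero_apply, zero_mul, Finset.sum_const_zero]
    linarith
  · have hR2 : R ^ 2 = ∑ i, (y i - w i) ^ 2 := l2norm_sq _
    have hpos' : 0 < R := hpos
    refine ⟨fun i => (y i - w i) / R, fun i => div_nonneg (sub_nonneg.2 (hwy i)) hpos'.le, ?_, ?_, ?_, ?_⟩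
    · simp only [div_pow]
      rw [← Finset.sum_div, ← hR2, div_self (by positivity)]
    · intro y'
      have hnorm : l2norm (fun i => (y i - w i) / R) ≤ 1 := by
        refine Real.sqrt_le_one.2 ?_
        simp only [div_pow]
        rw [← Finset.sum_div, ← hR2, div_self (by positivity)]
      have h1 : ∀ v ∈ C, R - ∑ i, (y i - w i) / R * (y i - y' i) ≤ l2norm (y' - v) := by
        intro v hv
        have h2 := sum_mul_le_l2norm_mul (fun i => (y i - w i) / R) (y' - v)
        have h3 : l2norm (fun i => (y i - w i) / R) * l2norm (y' - v) ≤ l2norm (y' - v) :=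
          mul_le_of_le_one_left (l2norm_nonneg _) hnorm
        have h4 : ∑ i, (y i - w i) / R * (v i - w i) ≤ 0 := by
          have : ∑ i, (y i - w i) / R * (v i - w i) = (∑ i, (y i - w i) * (v i - w i)) / R := by
            rw [Finset.sum_div]; exact Finset.sum_congr rfl fun i _ => by ring
          rw [this]
          exact div_nonpos_of_nonpos_of_nonneg (hcone v hv) hpos'.le
        have h5 : ∑ i, (y i - w i) / R * (y i - w i) = R := by
          have : ∑ i, (y i - w i) / R * (y i - w i) = (∑ i, (y i - w i) ^ 2) / R := by
            rw [Finset.sum_div]; exact Finset.sum_congr rfl fun i _ => by ring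
          rw [this, ← hR2]; field_simp
        have h6 : ∑ i, (y i - w i) / R * ((y' - v) i) =
            ∑ i, (y i - w i) / R * (y i - w i) - ∑ i, (y i - w i) / R * (y i - y' i) -
              ∑ i, (y i - w i) / R * (v i - w i) := by
          rw [← Finset.sum_sub_distrib, ← Finset.sum_sub_distrib]
          exact Finset.sum_congr rfl fun i _ => by rw [Pi.sub_apply]; ring
        linarith
      have := le_distL2 ⟨w, hw⟩ h1
      linarith
    · intro i l hil
      exact div_le_div_of_nonneg_right (hmono i l hil) hpos'.le
    · intro a b l hl
      rw [div_mul_div_comm, div_pow, sq R]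
      exact div_le_div_of_nonneg_right (hmid a b l hl) (by positivity)

lemma exists_isProfile_top {lam : ℝ} (hlam : 0 ≤ lam) (y : Fin n → ℝ) (hy : ∀ i, 0 ≤ y i) :
    ∃ u, IsProfile {w | lqNorm ⊤ w ≤ lam} y u := by
  have hmem : ∀ w : Fin n → ℝ, w ∈ {w : Fin n → ℝ | lqNorm ⊤ w ≤ lam} ↔ ∀ i, |w i| ≤ lam := by
    intro w
    simp only [Set.mem_ofPred_eq, lqNorm, if_true]
    exact ⟨fun h i => (le_ciSup (Set.finite_range fun i => |w i|).bddAbove i).trans h,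
      fun h => Real.iSup_le h hlam⟩
  refine exists_isProfile_of_residual (w := fun i => min (y i) lam) ((hmem _).2 fun i => ?_)
    (fun i => min_le_left _ _) (fun v hv => ?_) (fun i l hil => ?_) (fun a b l hl => ?_)
  · rw [abs_of_nonneg (le_min (hy i) hlam)]
    exact min_le_right _ _
  · refine Finset.sum_nonpos fun i _ => ?_
    rcases le_total (y i) lam with h | h
    · simp [min_eq_left h]
    · rw [min_eq_right h]
      have := (le_abs_self _).trans ((hmem v).1 hv i)
      exact mul_nonpos_of_nonneg_of_nonpos (by linarith) (by linarith)
  · rcases le_total (y i) lam with h | h <;> rcases le_total (y l) lam with h' | h' <;>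
      simp only [min_eq_left, min_eq_right, h, h'] <;> linarith
  · rcases le_total (y a) lam with h | h
    · simp only [min_eq_left h, sub_self, zero_mul]; positivity
    rcases le_total (y b) lam with h' | h'
    · simp only [min_eq_left h', sub_self, mul_zero]; positivity
    rw [min_eq_right h, min_eq_right h', min_eq_right (by linarith)]
    nlinarith [sq_nonneg (y a - y b)]

lemma abs_sub_min_abs_le {x y : ℝ} : (y - min |x| y) ^ 2 ≤ (y - x) ^ 2 := by
  rcases le_total |x| y with h | h
  · rw [min_eq_left h]
    have := le_abs_self x
    exact pow_le_pow_left₀ (by linarith) (by linarith) 2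
  · rw [min_eq_right h]
    simpa using sq_nonneg (y - x)

/-- First-order optimality for the projection onto an `ℓ^q` ball. -/
lemma residual_mul_rpow_le {q L : ℝ} (hq : 1 ≤ q) {y w : Fin n → ℝ} (hw0 : ∀ i, 0 ≤ w i)
    (hw : ∑ i, |w i| ^ q ≤ L) (hwy : ∀ i, w i ≤ y i)
    (hcone : ∀ v : Fin n → ℝ, ∑ i, |v i| ^ q ≤ L → ∑ i, (y i - w i) * (v i - w i) ≤ 0)
    (i l : Fin n) (hl : 0 < w l) :
    (y i - w i) * w l ^ (q - 1) ≤ (y l - w l) * w i ^ (q - 1) := by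
  by_cases hil : i = l
  · subst hil; exact le_rfl
  by_contra! hlt
  set A := w l ^ (q - 1)
  set B := w i ^ (q - 1)
  have hA : 0 < A := Real.rpow_pos_of_pos hl _
  have hrl : 0 ≤ y l - w l := sub_nonneg.2 (hwy l)
  obtain ⟨η, hη, hη2⟩ : ∃ η > 0, (y l - w l) * (B + η) < (y i - w i) * A := by
    refine ⟨((y i - w i) * A - (y l - w l) * B) / (2 * (y l - w l + 1)),
      div_pos (by linarith) (by linarith), ?_⟩
    have : (y l - w l) * (((y i - w i) * A - (y l - w l) * B) / (2 * (y l - w l + 1))) <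
        (y i - w i) * A - (y l - w l) * B := by
      rw [mul_div_assoc', div_lt_iff₀ (by linarith)]
      nlinarith
    linarith
  have hder : HasDerivAt (fun t : ℝ => (w i + t * A) ^ q + (w l - t * (B + η)) ^ q) (-(q * A * η)) 0 := by
    have h1 : HasDerivAt (fun t : ℝ => w i + t * A) A 0 := by
      simpa using ((hasDerivAt_id (0 : ℝ)).mul_const A).const_add (w i)
    have h2 : HasDerivAt (fun t : ℝ => w l - t * (B + η)) (-(B + η)) 0 := by
      simpa using ((hasDerivAt_id (0 : ℝ)).mul_const (B + η)).const_sub (w l)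
    have h3 := (h1.rpow_const (p := q) (Or.inr hq)).add (h2.rpow_const (p := q) (Or.inr hq))
    refine h3.congr_deriv ?_
    simp only [zero_mul, add_zero, sub_zero]
    change A * q * B + -(B + η) * q * A = _
    ring
  have hneg : -(q * A * η) < 0 := by
    have : 0 < q := by linarith
    have : 0 < q * A * η := by positivity
    linarith
  have hev1 : ∀ᶠ t in nhdsWithin (0 : ℝ) (Set.Ioi 0),
      (w i + t * A) ^ q + (w l - t * (B + η)) ^ q < w i ^ q + w l ^ q := by
    have hs := hder.hasDerivWithinAt (s := Set.Ioi 0)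
    rw [hasDerivWithinAt_iff_tendsto_slope' (by simp)] at hs
    filter_upwards [hs.eventually_lt_const hneg, self_mem_nhdsWithin] with t ht ht0
    have ht0' : (0 : ℝ) < t := ht0
    rw [slope_def_field, sub_zero, div_lt_iff₀ ht0'] at ht
    simp only [zero_mul, add_zero, sub_zero] at ht
    linarith
  have hev2 : ∀ᶠ t in nhdsWithin (0 : ℝ) (Set.Ioi 0), 0 < w l - t * (B + η) := by
    have hc : Tendsto (fun t : ℝ => w l - t * (B + η)) (nhdsWithin 0 (Set.Ioi 0)) (nhds (w l)) := by
      have : Continuous fun t : ℝ => w l - t * (B + η) := by fun_prop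
      have := this.tendsto 0
      simp only [zero_mul, sub_zero] at this
      exact this.mono_left nhdsWithin_le_nhds
    exact hc.eventually_const_lt hl
  obtain ⟨t, ⟨ht1, ht2⟩, ht0⟩ := ((hev1.and hev2).and self_mem_nhdsWithin).exists
  have ht0' : (0 : ℝ) < t := ht0
  set v : Fin n → ℝ := Function.update (Function.update w l (w l - t * (B + η))) i (w i + t * A)
  have hvi : v i = w i + t * A := by simp [v]
  have hvl : v l = w l - t * (B + η) := by simp [v, Function.update_of_ne (Ne.symm hil)]
  have hvo : ∀ k, k ≠ i → k ≠ l → v k = w k := fun k h1 h2 => by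
    simp [v, Function.update_of_ne h1, Function.update_of_ne h2]
  have hsplit : ∀ f : Fin n → ℝ, ∑ k, f k = f i + f l + ∑ k ∈ (Finset.univ.erase i).erase l, f k := by
    intro f
    rw [← Finset.add_sum_erase _ f (Finset.mem_univ i), ← Finset.add_sum_erase _ f
      (Finset.mem_erase.2 ⟨Ne.symm hil, Finset.mem_univ l⟩), add_assoc]
  have hrest : ∀ k ∈ (Finset.univ.erase i).erase l, v k = w k := fun k hk => by
    simp only [Finset.mem_erase] at hk
    exact hvo k hk.2.1 hk.1
  have hvL : ∑ k, |v k| ^ q ≤ L := by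
    refine le_trans ?_ hw
    rw [hsplit, hsplit fun k => |w k| ^ q, hvi, hvl, abs_of_pos ht2, abs_of_nonneg (hw0 i),
      abs_of_nonneg (hw0 l), abs_of_nonneg (add_nonneg (hw0 i) (by positivity))]
    refine add_le_add ht1.le (Finset.sum_congr rfl fun k hk => ?_).le
    rw [hrest k hk]
  have hc := hcone v hvL
  rw [hsplit, hvi, hvl, Finset.sum_eq_zero fun k hk => by rw [hrest k hk]; ring] at hc
  nlinarith [mul_pos ht0' (sub_pos.2 hη2)]

lemma exists_isProfile_of_rpow {q L : ℝ} (hq : 1 ≤ q) (hL : 0 ≤ L) (y : Fin n → ℝ)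
    (hy : ∀ i, 0 ≤ y i) : ∃ u, IsProfile {w : Fin n → ℝ | ∑ i, |w i| ^ q ≤ L} y u := by
  have hq0 : 0 < q := by linarith
  set C : Set (Fin n → ℝ) := {w : Fin n → ℝ | ∑ i, |w i| ^ q ≤ L} with hC
  have hclosed : IsClosed C := by
    refine isClosed_le ?_ continuous_const
    exact continuous_finsetSum _ fun i _ =>
      (continuous_abs.comp (continuous_apply i)).rpow_const fun _ => Or.inr hq0.le
  have hcomp : IsCompact C := by
    refine (isCompact_univ_pi fun _ : Fin n => isCompact_Icc (a := -(L ^ (1 / q))) (b := L ^ (1 / q))).of_isClosed_subset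
      hclosed fun w hw i _ => ?_
    rw [Set.mem_Icc, ← abs_le]
    have h1 : |w i| ^ q ≤ L := (Finset.single_le_sum (f := fun i => |w i| ^ q)
      (fun i _ => Real.rpow_nonneg (abs_nonneg _) _) (Finset.mem_univ i)).trans hw
    calc |w i| = (|w i| ^ q) ^ (1 / q) := by
          rw [← Real.rpow_mul (abs_nonneg _), mul_one_div_cancel hq0.ne', Real.rpow_one]
      _ ≤ _ := Real.rpow_le_rpow (Real.rpow_nonneg (abs_nonneg _) _) h1 (by positivity)
  have hne : C.Nonempty := ⟨0, by simp [hC, Real.zero_rpow hq0.ne', hL]⟩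
  have hconv : Convex ℝ C := by
    intro a ha b hb s t hs ht hst
    have h1 : ∀ i, |(s • a + t • b) i| ^ q ≤ s * |a i| ^ q + t * |b i| ^ q := by
      intro i
      have h2 := (convexOn_rpow hq).2 (Set.mem_Ici.2 (abs_nonneg (a i)))
        (Set.mem_Ici.2 (abs_nonneg (b i))) hs ht hst
      refine le_trans ?_ h2
      refine Real.rpow_le_rpow (abs_nonneg _) ?_ hq0.le
      refine (abs_add_le _ _).trans_eq ?_
      simp [abs_mul, abs_of_nonneg hs, abs_of_nonneg ht]
    have h2 := Finset.sum_le_sum fun i (_ : i ∈ Finset.univ) => h1 i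
    rw [Finset.sum_add_distrib, ← Finset.mul_sum, ← Finset.mul_sum] at h2
    have h3 : ∑ i, |a i| ^ q ≤ L := ha
    have h4 : ∑ i, |b i| ^ q ≤ L := hb
    have h5 : s * L + t * L = L := by rw [← add_mul, hst, one_mul]
    show ∑ i, |(s • a + t • b) i| ^ q ≤ L
    linarith [mul_le_mul_of_nonneg_left h3 hs, mul_le_mul_of_nonneg_left h4 ht]
  obtain ⟨w', hw', hmin'⟩ := hcomp.exists_isMinOn hne
    (continuous_l2norm.comp (continuous_const.sub continuous_id : Continuous fun w => y - w)).continuousOn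
  set w : Fin n → ℝ := fun i => min |w' i| (y i) with hw
  have hw0 : ∀ i, 0 ≤ w i := fun i => le_min (abs_nonneg _) (hy i)
  have hwy : ∀ i, w i ≤ y i := fun i => min_le_right _ _
  have hwC : w ∈ C := by
    have hw'L : ∑ i, |w' i| ^ q ≤ L := hw'
    show ∑ i, |w i| ^ q ≤ L
    refine le_trans (Finset.sum_le_sum fun i _ => ?_) hw'L
    refine Real.rpow_le_rpow (abs_nonneg _) ?_ hq0.le
    rw [abs_of_nonneg (hw0 i)]
    exact min_le_left _ _
  have hmin : ∀ v ∈ C, l2norm (y - w) ^ 2 ≤ l2norm (y - v) ^ 2 := by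
    intro v hv
    refine pow_le_pow_left₀ (l2norm_nonneg _) (le_trans ?_ (hmin' hv)) 2
    exact Real.sqrt_le_sqrt (Finset.sum_le_sum fun i _ => abs_sub_min_abs_le)
  have hcone : ∀ v ∈ C, ∑ i, (y i - w i) * (v i - w i) ≤ 0 := by
    intro v hv
    have h1 : ∀ t ∈ Set.Ioc (0 : ℝ) 1, ∑ i, (y i - w i) * (v i - w i) ≤ t * (l2norm (v - w) ^ 2 / 2) := by
      intro t ht
      have h2 := hmin _ (hconv hwC hv (sub_nonneg.2 ht.2) ht.1.le (by ring))
      have h3 : l2norm (y - ((1 - t) • w + t • v)) ^ 2 = l2norm (y - w) ^ 2 -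
          2 * t * ∑ i, (y i - w i) * (v i - w i) + t ^ 2 * l2norm (v - w) ^ 2 := by
        simp only [l2norm_sq, Finset.mul_sum, ← Finset.sum_sub_distrib, ← Finset.sum_add_distrib]
        refine Finset.sum_congr rfl fun i _ => ?_
        simp only [Pi.sub_apply, Pi.add_apply, Pi.smul_apply, smul_eq_mul]
        ring
      rw [h3] at h2
      have h4 : t * (∑ i, (y i - w i) * (v i - w i)) ≤ t * (t * (l2norm (v - w) ^ 2 / 2)) := by
        nlinarith
      exact le_of_mul_le_mul_left h4 ht.1
    by_contra! hpos
    set S := ∑ i, (y i - w i) * (v i - w i)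
    set M := l2norm (v - w) ^ 2 / 2 with hM
    have hM0 : 0 ≤ M := by positivity
    have ht : 0 < min 1 (S / (2 * (M + 1))) := lt_min one_pos (by positivity)
    have h5 := h1 _ ⟨ht, min_le_left _ _⟩
    have h6 : min 1 (S / (2 * (M + 1))) * M ≤ S / (2 * (M + 1)) * M := by
      gcongr; exact min_le_right _ _
    have h7 : S / (2 * (M + 1)) * M < S := by
      rw [div_mul_eq_mul_div, div_lt_iff₀ (by positivity)]
      nlinarith
    linarith
  have hex := residual_mul_rpow_le hq hw0 hwC hwy hcone
  have hr : ∀ i, 0 ≤ y i - w i := fun i => sub_nonneg.2 (hwy i)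
  have hq1 : 0 ≤ q - 1 := by linarith
  refine exists_isProfile_of_residual hwC hwy hcone (fun i l hil => ?_) (fun a b l hl => ?_)
  · by_contra! hlt
    have hwl : w i < w l := by linarith
    have hl0 : 0 < w l := (hw0 i).trans_lt hwl
    have h1 := hex i l hl0
    have h2 : w i ^ (q - 1) ≤ w l ^ (q - 1) := Real.rpow_le_rpow (hw0 i) hwl.le hq1
    have h3 : 0 < w l ^ (q - 1) := Real.rpow_pos_of_pos hl0 _
    nlinarith [hr l, mul_le_mul_of_nonneg_left h2 (hr l)]
  · by_contra! hlt
    have h1 : y l - w l < (y a - w a + (y b - w b)) / 2 := by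
      refine lt_of_pow_lt_pow_left₀ 2 (by linarith [hr a, hr b]) (hlt.trans_le ?_)
      nlinarith [sq_nonneg (y a - w a - (y b - w b))]
    have h2 : (w a + w b) / 2 < w l := by linarith
    have hl0 : 0 < w l := lt_of_le_of_lt (by linarith [hw0 a, hw0 b]) h2
    have h3 : w a * w b ≤ w l * w l := by nlinarith [sq_nonneg (w a - w b), hw0 a, hw0 b]
    have h4 := Real.rpow_le_rpow (mul_nonneg (hw0 a) (hw0 b)) h3 hq1
    rw [Real.mul_rpow (hw0 a) (hw0 b), Real.mul_rpow hl0.le hl0.le] at h4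
    have h5 := mul_le_mul (hex a l hl0) (hex b l hl0)
      (mul_nonneg (hr b) (Real.rpow_nonneg hl0.le _)) (mul_nonneg (hr l) (Real.rpow_nonneg (hw0 a) _))
    have h6 : 0 < w l ^ (q - 1) := Real.rpow_pos_of_pos hl0 _
    have h7 := mul_le_mul_of_nonneg_left h4 (sq_nonneg (y l - w l))
    have h8 : (y a - w a) * (y b - w b) * (w l ^ (q - 1) * w l ^ (q - 1)) ≤
        (y l - w l) ^ 2 * (w l ^ (q - 1) * w l ^ (q - 1)) := by linarith
    have := le_of_mul_le_mul_right h8 (by positivity)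
    linarith

lemma exists_isProfile {q : ℝ≥0∞} (hq : 1 ≤ q) {lam : ℝ} (hlam : 0 ≤ lam) (y : Fin n → ℝ)
    (hy : ∀ i, 0 ≤ y i) : ∃ u, IsProfile {w | lqNorm q w ≤ lam} y u := by
  by_cases hqt : q = ⊤
  · subst hqt
    exact exists_isProfile_top hlam y hy
  · have hq1 : 1 ≤ q.toReal := by
      rw [← ENNReal.toReal_one]
      exact ENNReal.toReal_mono hqt hq
    have hq0 : 0 < q.toReal := by linarith
    have : {w : Fin n → ℝ | lqNorm q w ≤ lam} = {w | ∑ i, |w i| ^ q.toReal ≤ lam ^ q.toReal} := by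
      ext w
      have h0 : 0 ≤ ∑ i, |w i| ^ q.toReal :=
        Finset.sum_nonneg fun i _ => Real.rpow_nonneg (abs_nonneg _) _
      simp only [Set.mem_ofPred_eq, lqNorm, if_neg hqt]
      rw [one_div]
      exact Real.rpow_inv_le_iff_of_pos h0 hlam hq0
    rw [this]
    exact exists_isProfile_of_rpow hq1 (Real.rpow_nonneg hlam _) y hy

end Projection

/-! ### Window masses of a profile -/

section WindowMass

variable {n : ℕ} {C : Set (Fin n → ℝ)} {x u : Fin n → ℝ} {β B : ℝ}

lemma IsProfile.rank_mul_sq_le (hu : IsProfile C (β • x) u) (hβ : 0 < β) (hx : Antitone x)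
    (i : Fin n) : ((i : ℝ) + 1) * u i ^ 2 ≤ 1 := by
  refine le_trans ?_ hu.sum_sq_le
  calc ((i : ℝ) + 1) * u i ^ 2 = ∑ l ∈ Finset.Iic i, u i ^ 2 := by
        rw [Finset.sum_const, Fin.card_Iic, nsmul_eq_mul]; push_cast; ring
    _ ≤ ∑ l ∈ Finset.Iic i, u l ^ 2 := by
        refine Finset.sum_le_sum fun l hl => pow_le_pow_left₀ (hu.nonneg i) (hu.mono i l ?_) 2
        exact mul_le_mul_of_nonneg_left (hx (Finset.mem_Iic.1 hl)) hβ.le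
    _ ≤ ∑ l, u l ^ 2 :=
        Finset.sum_le_sum_of_subset_of_nonneg (Finset.subset_univ _) fun _ _ _ => sq_nonneg _

lemma exists_le_gaussQuantile {y : ℝ} (hy : 0 ≤ y) (h1 : 1 ≤ (n : ℝ) * gaussTail y) :
    ∃ l : Fin n, y ≤ gaussQuantile n l ∧ (n : ℝ) * gaussTail y ≤ 2 * ((l : ℝ) + 1) := by
  set N := ⌊(n : ℝ) * gaussTail y⌋₊
  have hN : 1 ≤ N := Nat.le_floor (by simpa using h1)
  have hN' : (N : ℝ) ≤ n * gaussTail y := Nat.floor_le (by linarith)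
  have hlt : (n : ℝ) * gaussTail y < N + 1 := Nat.lt_floor_add_one _
  have ht1 : gaussTail y ≤ 1 := by
    rw [← gaussTail_zero]
    exact gaussTail_strictAnti.antitone hy
  have hNn : N ≤ n := by
    have : (N : ℝ) ≤ n := hN'.trans (mul_le_of_le_one_right (Nat.cast_nonneg n) ht1)
    exact_mod_cast this
  have hn0 : (0 : ℝ) < n := by exact_mod_cast (by omega : 0 < n)
  have hcast : (((N - 1 : ℕ) : ℝ)) = N - 1 := by push_cast [Nat.cast_sub hN]; ring
  refine ⟨⟨N - 1, by omega⟩, ?_, ?_⟩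
  · have h2 := natCast_mul_gaussTail_gaussQuantile (n := n) ⟨N - 1, by omega⟩
    simp only [hcast] at h2
    by_contra! hlt'
    have h3 := gaussTail_strictAnti hlt'
    nlinarith
  · have : (1 : ℝ) ≤ N := by exact_mod_cast hN
    simp only [hcast]
    linarith

lemma IsProfile.rank_mul_rank_mul_sq_le (hu : IsProfile C (β • x) u) (hβ : 0 < β)
    (hx : Antitone x) (hB : 0 ≤ B) (hxB : ∀ i, |x i - gaussQuantile n i| ≤ B) {i k : Fin n}
    (hik : winIdx i + 2 ≤ winIdx k) :
    ((i : ℝ) + 1) * ((k : ℝ) + 1) * (u i * u k) ^ 2 ≤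
      64 * Real.exp (2 * (2 * B + 1) * ((winIdx k : ℝ) + 1) ^ 3 + (2 * B + 1) ^ 2 -
        (winIdx k : ℝ) ^ 4 / 4) := by
  set b : ℝ := (winIdx k : ℝ) with hb
  have hb2 : (winIdx i : ℝ) + 2 ≤ b := by rw [hb]; exact_mod_cast hik
  have hi0 : (0 : ℝ) ≤ winIdx i := Nat.cast_nonneg _
  have hb0 : 0 ≤ b := by linarith
  by_cases hbB : b ^ 2 < 4 * B
  · have h1 := hu.rank_mul_sq_le hβ hx i
    have h2 := hu.rank_mul_sq_le hβ hx k
    have h3 := mul_le_mul h1 h2 (by positivity) zero_le_one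
    have h4 : 0 ≤ 2 * (2 * B + 1) * (b + 1) ^ 3 + (2 * B + 1) ^ 2 - b ^ 4 / 4 := by
      have : b ^ 4 ≤ (4 * B) ^ 2 := by
        calc b ^ 4 = (b ^ 2) ^ 2 := by ring
          _ ≤ _ := pow_le_pow_left₀ (by positivity) hbB.le 2
      have : 0 ≤ 2 * (2 * B + 1) * (b + 1) ^ 3 := by positivity
      nlinarith
    have h5 := Real.one_le_exp h4
    nlinarith
  push Not at hbB
  set s := gaussQuantile n i with hs
  set t := gaussQuantile n k with ht
  have hs0 : 0 ≤ s := gaussQuantile_nonneg i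
  have ht0 : 0 ≤ t := gaussQuantile_nonneg k
  have hs1 : s ≤ (b - 1) ^ 3 :=
    (lt_winIdx_pow i).le.trans (pow_le_pow_left₀ (by linarith) (by linarith) 3)
  have ht1 : b ^ 3 ≤ t := winIdx_pow_le k
  have ht2 : t ≤ (b + 1) ^ 3 := (lt_winIdx_pow k).le
  have hst : b ^ 2 ≤ t - s := by nlinarith
  set y := (s + t) / 2 + 2 * B with hy
  have hy0 : 0 ≤ y := by positivity
  have hyt : y ≤ t := by rw [hy]; linarith
  have hpi : (n : ℝ) * gaussTail s = (i : ℝ) + 1 := natCast_mul_gaussTail_gaussQuantile i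
  have hpk : (n : ℝ) * gaussTail t = (k : ℝ) + 1 := natCast_mul_gaussTail_gaussQuantile k
  have hk0 : (0 : ℝ) ≤ (k : ℕ) := Nat.cast_nonneg _
  have hn0 : (0 : ℝ) < n := by exact_mod_cast (Fin.pos i)
  have hpy : 1 ≤ (n : ℝ) * gaussTail y := by
    have := mul_le_mul_of_nonneg_left (gaussTail_strictAnti.antitone hyt) hn0.le
    linarith
  obtain ⟨l, hyl, hl⟩ := exists_le_gaussQuantile hy0 hpy
  have hxl : (x i + x k) / 2 ≤ x l := by
    have h1 := (abs_le.1 (hxB i)).2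
    have h2 := (abs_le.1 (hxB k)).2
    have h3 := (abs_le.1 (hxB l)).1
    rw [hy] at hyl
    linarith
  have hul : u i * u k ≤ u l ^ 2 := by
    refine hu.mid i k l ?_
    simp only [Pi.smul_apply, smul_eq_mul]
    nlinarith
  have hik0 : 0 ≤ u i * u k := mul_nonneg (hu.nonneg i) (hu.nonneg k)
  have h1 : (n : ℝ) * gaussTail y * (u i * u k) ≤ 2 := by
    have h2 := hu.rank_mul_sq_le hβ hx l
    have h3 : (n : ℝ) * gaussTail y * (u i * u k) ≤ 2 * ((l : ℝ) + 1) * u l ^ 2 :=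
      mul_le_mul hl hul hik0 (by positivity)
    linarith
  have hty : 0 < gaussTail y := gaussTail_pos _
  have h2 : gaussTail s * gaussTail t ≤
      16 * Real.exp (2 * (2 * B + 1) * (b + 1) ^ 3 + (2 * B + 1) ^ 2 - b ^ 4 / 4) *
        gaussTail y ^ 2 := by
    have h3 : gaussTail s * gaussTail t ≤ (2 * Real.exp (-s ^ 2 / 2)) * (2 * Real.exp (-t ^ 2 / 2)) :=
      mul_le_mul (gaussTail_le_exp hs0) (gaussTail_le_exp ht0) (gaussTail_pos _).le (by positivity)
    have h4 : (1 / 2 * Real.exp (-(y + 1) ^ 2 / 2)) ^ 2 ≤ gaussTail y ^ 2 :=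
      pow_le_pow_left₀ (by positivity) (exp_le_gaussTail hy0) 2
    refine h3.trans (le_trans ?_ (mul_le_mul_of_nonneg_left h4 (by positivity)))
    have h5 : (2 * Real.exp (-s ^ 2 / 2)) * (2 * Real.exp (-t ^ 2 / 2)) =
        4 * Real.exp (-s ^ 2 / 2 + -t ^ 2 / 2) := by rw [Real.exp_add]; ring
    have h6 : ∀ e : ℝ, 16 * Real.exp e * (1 / 2 * Real.exp (-(y + 1) ^ 2 / 2)) ^ 2 =
        4 * Real.exp (e + -(y + 1) ^ 2) := by
      intro e
      have : Real.exp (-(y + 1) ^ 2) = Real.exp (-(y + 1) ^ 2 / 2) ^ 2 := by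
        rw [← Real.exp_nat_mul]; congr 1; push_cast; ring
      rw [Real.exp_add, this]; ring
    rw [h5, h6]
    refine mul_le_mul_of_nonneg_left (Real.exp_le_exp.2 ?_) (by norm_num)
    have h7 : b ^ 4 ≤ (t - s) ^ 2 := by
      calc b ^ 4 = (b ^ 2) ^ 2 := by ring
        _ ≤ _ := pow_le_pow_left₀ (by positivity) hst 2
    have h8 : (s + t) / 2 ≤ (b + 1) ^ 3 := by linarith [pow_nonneg hb0 2]
    have h9 := mul_le_mul_of_nonneg_left h8 (show 0 ≤ 2 * (2 * B + 1) by positivity)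
    have h10 : (y + 1) ^ 2 = ((s + t) / 2) ^ 2 + 2 * (2 * B + 1) * ((s + t) / 2) + (2 * B + 1) ^ 2 := by
      rw [hy]; ring
    have h11 : s ^ 2 / 2 + t ^ 2 / 2 = ((s + t) / 2) ^ 2 + (t - s) ^ 2 / 4 := by ring
    have h12 : -s ^ 2 / 2 + -t ^ 2 / 2 = -(s ^ 2 / 2 + t ^ 2 / 2) := by ring
    rw [h12, h11, h10]
    linarith
  have h3 : ((n : ℝ) * gaussTail y * (u i * u k)) ^ 2 ≤ 4 := by
    have : 0 ≤ (n : ℝ) * gaussTail y * (u i * u k) := by positivity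
    nlinarith
  rw [← hpi, ← hpk]
  set E := Real.exp (2 * (2 * B + 1) * (b + 1) ^ 3 + (2 * B + 1) ^ 2 - b ^ 4 / 4)
  have hE : 0 < E := Real.exp_pos _
  calc n * gaussTail s * (n * gaussTail t) * (u i * u k) ^ 2
      = gaussTail s * gaussTail t * (n * (u i * u k)) ^ 2 := by ring
    _ ≤ 16 * E * gaussTail y ^ 2 * (n * (u i * u k)) ^ 2 := by gcongr
    _ = 16 * E * (n * gaussTail y * (u i * u k)) ^ 2 := by ring
    _ ≤ 16 * E * 4 := by gcongr
    _ = _ := by ring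

/-- The constant in the bound on products of masses of distant windows. -/
noncomputable def windowConst (B : ℝ) : ℝ :=
  96 * Real.exp (64 ^ 3 * (2 * B + 10) ^ 4 + (2 * B + 1) ^ 2)

lemma windowConst_pos (B : ℝ) : 0 < windowConst B := by unfold windowConst; positivity

lemma exp_mul_pow_le_windowConst (hB : 0 ≤ B) {b : ℝ} (hb : 0 ≤ b) :
    64 * Real.exp (2 * (2 * B + 1) * (b + 1) ^ 3 + (2 * B + 1) ^ 2 - b ^ 4 / 4) *
      (144 * (b + 1) ^ 10) ≤ (windowConst B / (b + 1) ^ 4) ^ 2 := by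
  have h1 : (b + 1) ^ 18 ≤ Real.exp (18 * (b + 1)) := by
    have h2 : b + 1 ≤ Real.exp (b + 1) := by linarith [Real.add_one_le_exp (b + 1)]
    calc (b + 1) ^ 18 ≤ Real.exp (b + 1) ^ 18 := pow_le_pow_left₀ (by positivity) h2 18
      _ = _ := by rw [← Real.exp_nat_mul]; norm_num
  rw [div_pow, le_div_iff₀ (by positivity)]
  have h3 : (windowConst B) ^ 2 =
      9216 * Real.exp (2 * (64 ^ 3 * (2 * B + 10) ^ 4 + (2 * B + 1) ^ 2)) := by
    rw [windowConst, mul_pow, ← Real.exp_nat_mul]; norm_num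
  rw [h3]
  calc _ = 9216 * (Real.exp (2 * (2 * B + 1) * (b + 1) ^ 3 + (2 * B + 1) ^ 2 - b ^ 4 / 4) *
        (b + 1) ^ 18) := by ring
    _ ≤ 9216 * (Real.exp (2 * (2 * B + 1) * (b + 1) ^ 3 + (2 * B + 1) ^ 2 - b ^ 4 / 4) *
        Real.exp (18 * (b + 1))) := by gcongr
    _ ≤ _ := by
      rw [← Real.exp_add]
      gcongr
      set X := b + 1 with hX
      have hX1 : 1 ≤ X := by linarith
      set E := 2 * B + 10 with hE
      have hE0 : 0 < E := by linarith
      have h4 : X ^ 4 ≤ 8 * (b ^ 4 + 1) := by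
        rw [hX]
        nlinarith [sq_nonneg (b - 1), sq_nonneg (b ^ 2 - 1), sq_nonneg (b * (b - 1)), sq_nonneg (b^2 - b)]
      have h5 : X ≤ X ^ 3 := by nlinarith [mul_nonneg (sub_nonneg.2 hX1) (sub_nonneg.2 hX1)]
      have h6 : X ^ 3 * (E - X / 64) ≤ 64 ^ 3 * E ^ 4 := by
        by_cases h : 64 * E ≤ X
        · have : X ^ 3 * (E - X / 64) ≤ 0 :=
            mul_nonpos_of_nonneg_of_nonpos (by positivity) (by linarith)
          have : 0 ≤ 64 ^ 3 * E ^ 4 := by positivity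
          linarith
        · push Not at h
          calc X ^ 3 * (E - X / 64) ≤ X ^ 3 * E := by
                have : 0 ≤ X / 64 := by positivity
                gcongr; linarith
            _ ≤ (64 * E) ^ 3 * E := by gcongr
            _ = _ := by ring
      have h7 : (1 : ℝ) ≤ (2 * B + 1) ^ 2 := by nlinarith
      have h8 : 2 * (2 * B + 1) * X ^ 3 = 2 * (E * X ^ 3) - 18 * X ^ 3 := by rw [hE]; ring
      linarith
end WindowMass

section WindowMassSum

variable {n : ℕ} {C : Set (Fin n → ℝ)} {x u : Fin n → ℝ} {β B : ℝ}

/-- The mass of `u` on a window of ranks. -/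
noncomputable def windowMass (u : Fin n → ℝ) (j : ℕ) : ℝ := ∑ i ∈ window n j, u i ^ 2

lemma windowMass_nonneg (u : Fin n → ℝ) (j : ℕ) : 0 ≤ windowMass u j :=
  Finset.sum_nonneg fun _ _ => sq_nonneg _

lemma IsProfile.windowMass_mul_le (hu : IsProfile C (β • x) u) (hβ : 0 < β)
    (hx : Antitone x) (hB : 0 ≤ B) (hxB : ∀ i, |x i - gaussQuantile n i| ≤ B) {a b : ℕ}
    (hab : a + 2 ≤ b) :
    windowMass u a * windowMass u b ≤
      (windowConst B * ((1 / ((a : ℝ) + 1)) ^ 2 * (1 / ((b : ℝ) + 1)) ^ 2)) ^ 2 := by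
  set E := 64 * Real.exp (2 * (2 * B + 1) * ((b : ℝ) + 1) ^ 3 + (2 * B + 1) ^ 2 - (b : ℝ) ^ 4 / 4)
    with hE
  have hE0 : 0 < E := by positivity
  have hab' : (a : ℝ) + 1 ≤ b + 1 := by exact_mod_cast (by omega : a + 1 ≤ b + 1)
  have h1 : windowMass u a * windowMass u b ≤
      E * ((∑ i ∈ window n a, 1 / ((i : ℝ) + 1)) * ∑ k ∈ window n b, 1 / ((k : ℝ) + 1)) := by
    rw [windowMass, windowMass, Finset.sum_mul_sum, Finset.sum_mul_sum, Finset.mul_sum]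
    refine Finset.sum_le_sum fun i hi => ?_
    rw [Finset.mul_sum]
    refine Finset.sum_le_sum fun k hk => ?_
    rw [mem_window] at hi hk
    have h2 := hu.rank_mul_rank_mul_sq_le hβ hx hB hxB (i := i) (k := k) (by omega)
    rw [hk, ← hE] at h2
    rw [div_mul_div_comm, one_mul, mul_one_div, le_div_iff₀ (by positivity)]
    linarith
  refine h1.trans ?_
  have h3 : (∑ i ∈ window n a, 1 / ((i : ℝ) + 1)) * ∑ k ∈ window n b, 1 / ((k : ℝ) + 1) ≤
      144 * ((b : ℝ) + 1) ^ 10 := by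
    calc _ ≤ (12 * ((a : ℝ) + 1) ^ 5) * (12 * ((b : ℝ) + 1) ^ 5) :=
          mul_le_mul (sum_window_inv_rank_le n a) (sum_window_inv_rank_le n b)
            (Finset.sum_nonneg fun _ _ => by positivity) (by positivity)
      _ ≤ (12 * ((b : ℝ) + 1) ^ 5) * (12 * ((b : ℝ) + 1) ^ 5) := by gcongr
      _ = _ := by ring
  refine (mul_le_mul_of_nonneg_left h3 hE0.le).trans
    ((exp_mul_pow_le_windowConst hB (Nat.cast_nonneg b)).trans ?_)
  have hK := windowConst_pos B
  refine pow_le_pow_left₀ (by positivity) ?_ 2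
  rw [div_eq_mul_one_div (windowConst B)]
  refine mul_le_mul_of_nonneg_left ?_ hK.le
  calc 1 / ((b : ℝ) + 1) ^ 4 = (1 / ((b : ℝ) + 1)) ^ 2 * (1 / ((b : ℝ) + 1)) ^ 2 := by
        field_simp
    _ ≤ _ := by gcongr

/-- A bound on the sum of the root masses of well-separated windows. -/
noncomputable def rootMassConst (B : ℝ) : ℝ :=
  Real.sqrt (1 + windowConst B * (∑' j : ℕ, (1 / ((j : ℝ) + 1)) ^ 2) ^ 2)

lemma IsProfile.sum_sqrt_windowMass_le_of_separated (hu : IsProfile C (β • x) u) (hβ : 0 < β)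
    (hx : Antitone x) (hB : 0 ≤ B) (hxB : ∀ i, |x i - gaussQuantile n i| ≤ B) {J : Finset ℕ}
    (hJ : J ⊆ Finset.univ.image (winIdx : Fin n → ℕ))
    (hsep : ∀ a ∈ J, ∀ b ∈ J, a < b → a + 2 ≤ b) :
    ∑ j ∈ J, Real.sqrt (windowMass u j) ≤ rootMassConst B := by
  have hK := windowConst_pos B
  set z : ℕ → ℝ := fun j => (1 / ((j : ℝ) + 1)) ^ 2 with hz
  have hz0 : ∀ j, 0 ≤ z j := fun j => by positivity
  have hlt : ∀ a ∈ J, ∀ b ∈ J, a < b →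
      Real.sqrt (windowMass u a) * Real.sqrt (windowMass u b) ≤ windowConst B * (z a * z b) := by
    intro a ha b hb hab
    rw [← Real.sqrt_mul (windowMass_nonneg u a)]
    exact Real.sqrt_le_iff.2 ⟨by positivity, hu.windowMass_mul_le hβ hx hB hxB (hsep a ha b hb hab)⟩
  have hpair : ∀ a ∈ J, ∀ b ∈ J, Real.sqrt (windowMass u a) * Real.sqrt (windowMass u b) ≤
      (if a = b then windowMass u a else 0) + windowConst B * (z a * z b) := by
    intro a ha b hb
    rcases lt_trichotomy a b with h | h | h
    · rw [if_neg h.ne, zero_add]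
      exact hlt a ha b hb h
    · subst h
      rw [if_pos rfl, Real.mul_self_sqrt (windowMass_nonneg u a)]
      exact le_add_of_nonneg_right (by positivity)
    · rw [if_neg h.ne', zero_add, mul_comm, mul_comm (z a)]
      exact hlt b hb a ha h
  have hmass : ∑ j ∈ J, windowMass u j ≤ 1 := by
    refine le_trans ?_ hu.sum_sq_le
    rw [sum_eq_sum_window]
    exact Finset.sum_le_sum_of_subset_of_nonneg hJ fun j _ _ => windowMass_nonneg u j
  have hzsum : ∑ j ∈ J, z j ≤ ∑' j, z j :=
    summable_inv_succ_sq.sum_le_tsum J fun j _ => hz0 j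
  refine Real.le_sqrt_of_sq_le ?_
  calc (∑ j ∈ J, Real.sqrt (windowMass u j)) ^ 2
      = ∑ a ∈ J, ∑ b ∈ J, Real.sqrt (windowMass u a) * Real.sqrt (windowMass u b) := by
        rw [sq, Finset.sum_mul_sum]
    _ ≤ ∑ a ∈ J, ∑ b ∈ J, ((if a = b then windowMass u a else 0) + windowConst B * (z a * z b)) :=
        Finset.sum_le_sum fun a ha => Finset.sum_le_sum fun b hb => hpair a ha b hb
    _ = ∑ j ∈ J, windowMass u j + windowConst B * (∑ j ∈ J, z j) ^ 2 := by
        simp only [Finset.sum_add_distrib, ← Finset.mul_sum]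
        congr 1
        · exact Finset.sum_congr rfl fun a ha => by rw [Finset.sum_ite_eq, if_pos ha]
        · rw [← Finset.sum_mul, sq]
    _ ≤ 1 + windowConst B * (∑' j, z j) ^ 2 := by
        have := Finset.sum_nonneg fun j (_ : j ∈ J) => hz0 j
        gcongr

lemma IsProfile.sum_sqrt_windowMass_le (hu : IsProfile C (β • x) u) (hβ : 0 < β)
    (hx : Antitone x) (hB : 0 ≤ B) (hxB : ∀ i, |x i - gaussQuantile n i| ≤ B) :
    ∑ j ∈ Finset.univ.image (winIdx : Fin n → ℕ), Real.sqrt (windowMass u j) ≤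
      2 * rootMassConst B := by
  rw [← Finset.sum_filter_add_sum_filter_not _ (fun j => Even j), two_mul]
  refine add_le_add
    (hu.sum_sqrt_windowMass_le_of_separated hβ hx hB hxB (Finset.filter_subset _ _) ?_)
    (hu.sum_sqrt_windowMass_le_of_separated hβ hx hB hxB (Finset.filter_subset _ _) ?_)
  · intro a ha b hb hab
    obtain ⟨r, hr⟩ := (Finset.mem_filter.1 ha).2
    obtain ⟨s, hs⟩ := (Finset.mem_filter.1 hb).2
    omega
  · intro a ha b hb hab
    obtain ⟨r, hr⟩ := Nat.not_even_iff_odd.1 (Finset.mem_filter.1 ha).2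
    obtain ⟨s, hs⟩ := Nat.not_even_iff_odd.1 (Finset.mem_filter.1 hb).2
    omega

lemma distL2_sub_le_of_window {q : ℝ≥0∞} (hq : 1 ≤ q) {lam : ℝ} (hlam : 0 ≤ lam) (hβ : 0 < β)
    (hβ1 : β ≤ 1) (hx0 : ∀ i, 0 ≤ x i) (hx : Antitone x) {V : ℝ}
    (hxB : ∀ i, |x i - gaussQuantile n i| ≤ Real.sqrt V) {x' : Fin n → ℝ}
    (hV : ∀ j, ∑ i ∈ window n j, (x i - x' i) ^ 2 ≤ V) :
    distL2 {w | lqNorm q w ≤ lam} (β • x) - distL2 {w | lqNorm q w ≤ lam} (β • x') ≤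
      2 * rootMassConst (Real.sqrt V) * Real.sqrt V := by
  obtain ⟨u, hu⟩ := exists_isProfile hq hlam (β • x) fun i => mul_nonneg hβ.le (hx0 i)
  refine (hu.sub_le _).trans ?_
  rw [sum_eq_sum_window]
  refine le_trans ?_ (mul_le_mul_of_nonneg_right
    (hu.sum_sqrt_windowMass_le hβ hx (Real.sqrt_nonneg V) hxB) (Real.sqrt_nonneg V))
  rw [Finset.sum_mul]
  refine Finset.sum_le_sum fun j _ => ?_
  have h1 : ∑ i ∈ window n j, u i * ((β • x) i - (β • x') i) =
      β * ∑ i ∈ window n j, u i * (x i - x' i) := by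
    rw [Finset.mul_sum]
    exact Finset.sum_congr rfl fun i _ => by simp only [Pi.smul_apply, smul_eq_mul]; ring
  have h2 := Real.sum_mul_le_sqrt_mul_sqrt (window n j) u fun i => x i - x' i
  have h3 : Real.sqrt (∑ i ∈ window n j, u i ^ 2) * Real.sqrt (∑ i ∈ window n j, (x i - x' i) ^ 2) ≤
      Real.sqrt (windowMass u j) * Real.sqrt V :=
    mul_le_mul_of_nonneg_left (Real.sqrt_le_sqrt (hV j)) (Real.sqrt_nonneg _)
  have h4 : 0 ≤ Real.sqrt (windowMass u j) * Real.sqrt V := by positivity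
  rw [h1]
  calc β * ∑ i ∈ window n j, u i * (x i - x' i)
      ≤ β * (Real.sqrt (windowMass u j) * Real.sqrt V) := by gcongr; exact h2.trans h3
    _ ≤ _ := mul_le_of_le_one_left h4 hβ1

end WindowMassSum

/-! ### Distances of a Gaussian vector to `ℓ^q` balls -/

section Core

variable {n : ℕ}

lemma lqNorm_signed_perm (q : ℝ≥0∞) (σ : Equiv.Perm (Fin n)) {w w' : Fin n → ℝ}
    (h : ∀ i, |w' i| = |w (σ i)|) : lqNorm q w' = lqNorm q w := by
  unfold lqNorm
  simp only [h]
  rw [Equiv.sum_comp σ fun i => |w i| ^ q.toReal, Equiv.iSup_comp σ (g := fun i => |w i|)]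

lemma zero_mem_lqBall {q : ℝ≥0∞} (hq : 1 ≤ q) {lam : ℝ} (hlam : 0 ≤ lam) :
    (0 : Fin n → ℝ) ∈ {w : Fin n → ℝ | lqNorm q w ≤ lam} := by
  have : lqNorm q (0 : Fin n → ℝ) = 0 := by
    unfold lqNorm
    split_ifs with h
    · simp
    · have hq0 : q.toReal ≠ 0 := (ENNReal.toReal_pos (zero_lt_one.trans_le hq).ne' h).ne'
      simp [Real.zero_rpow hq0, Real.zero_rpow (inv_ne_zero hq0)]
  simpa [this] using hlam

/-- Distances to `ℓ^q` balls only depend on the sorted absolute values. -/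
lemma distL2_lqBall_sorted {q : ℝ≥0∞} (hq : 1 ≤ q) {lam : ℝ} (hlam : 0 ≤ lam)
    (σ : Equiv.Perm (Fin n)) (h : Fin n → ℝ) :
    distL2 {w | lqNorm q w ≤ lam} (fun i => |h (σ i)|) = distL2 {w | lqNorm q w ≤ lam} h := by
  set s : Fin n → ℝ := fun i => if 0 ≤ h i then 1 else -1 with hs
  have hs2 : ∀ i, |s i| = 1 := fun i => by simp only [hs]; split_ifs <;> simp
  have hsh : ∀ i, |h i| = s i * h i := fun i => by
    simp only [hs]; split_ifs with hi
    · rw [abs_of_nonneg hi, one_mul]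
    · rw [abs_of_neg (not_le.1 hi)]; ring
  have hss : ∀ i, s i * s i = 1 := fun i => by rw [← abs_mul_abs_self, hs2, one_mul]
  have hne : ({w : Fin n → ℝ | lqNorm q w ≤ lam}).Nonempty := ⟨0, zero_mem_lqBall hq hlam⟩
  refine le_antisymm (le_distL2 hne fun w hw => ?_) (le_distL2 hne fun w hw => ?_)
  · refine (distL2_le (w := fun i => s (σ i) * w (σ i)) ?_ _).trans_eq ?_
    · rw [Set.mem_ofPred_eq, lqNorm_signed_perm q σ (w := w) fun i => by rw [abs_mul, hs2, one_mul]]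
      exact hw
    · unfold l2norm
      congr 1
      rw [← Equiv.sum_comp σ fun i => (h - w) i ^ 2]
      refine Finset.sum_congr rfl fun i _ => ?_
      simp only [Pi.sub_apply, hsh]
      rw [← mul_sub, mul_pow, sq (s (σ i)), hss, one_mul]
  · refine (distL2_le (w := fun i => s i * w (σ.symm i)) ?_ _).trans_eq ?_
    · rw [Set.mem_ofPred_eq, lqNorm_signed_perm q σ.symm (w := w) fun i => by rw [abs_mul, hs2, one_mul]]
      exact hw
    · unfold l2norm
      congr 1
      rw [← Equiv.sum_comp σ fun i => (h - fun i => s i * w (σ.symm i)) i ^ 2]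
      refine Finset.sum_congr rfl fun i _ => ?_
      simp only [Pi.sub_apply, hsh, Equiv.symm_apply_apply]
      have : h (σ i) - s (σ i) * w i = s (σ i) * (s (σ i) * h (σ i) - w i) := by
        rw [mul_sub, ← mul_assoc, hss, one_mul]
      rw [this, mul_pow, sq (s (σ i)), hss, one_mul]

/-- A universal bound on the fluctuation of distances to dilated `ℓ^q` balls. -/
noncomputable def coreConst : ℝ :=
  2 * rootMassConst (Real.sqrt (Real.sqrt (2 * fluctConst))) *
    Real.sqrt (Real.sqrt (2 * fluctConst))

lemma coreConst_nonneg : 0 ≤ coreConst := by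
  unfold coreConst rootMassConst; positivity

/-- Outside a set at small distance from most points, all distances to `ℓ^q` balls are
simultaneously close to their values at the vector of quantiles. -/
lemma exists_forall_abs_distL2_sub_le (n : ℕ) : ∃ K : Set (Fin n → ℝ),
    1 / 2 ≤ _root_.stdGaussian n K ∧ ∀ q : ℝ≥0∞, 1 ≤ q → ∀ lam : ℝ, 0 ≤ lam →
      ∀ β : ℝ, 0 < β → β < 1 → ∀ h : Fin n → ℝ,
        |distL2 {w | lqNorm q w ≤ lam} (β • h) -
          distL2 {w | lqNorm q w ≤ lam} (β • gaussQuantile n)| ≤ coreConst + distL2 K h := by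
  obtain ⟨K, hK, hKV⟩ := exists_orderStatistics_close n
  refine ⟨K, hK, fun q hq lam hlam β hβ hβ1 h => ?_⟩
  set f := distL2 {w : Fin n → ℝ | lqNorm q w ≤ lam} with hf
  have hne : ({w : Fin n → ℝ | lqNorm q w ≤ lam}).Nonempty := ⟨0, zero_mem_lqBall hq hlam⟩
  have hKne : K.Nonempty := by
    by_contra hemp
    rw [Set.not_nonempty_iff_eq_empty] at hemp
    simp [hemp] at hK
  have hmem : ∀ k ∈ K, |f (β • k) - f (β • gaussQuantile n)| ≤ coreConst := by
    intro k hk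
    set σ := Tuple.sort fun i => -|k i| with hσ
    have hx : Antitone fun i => |k (σ i)| := fun i j hij => by
      have := Tuple.monotone_sort (fun i => -|k i|) hij
      simpa using this
    have hV := hKV k hk σ hx
    set V := Real.sqrt (2 * fluctConst)
    have hB : ∀ i, |(|k (σ i)|) - gaussQuantile n i| ≤ Real.sqrt V := by
      intro i
      refine Real.abs_le_sqrt (le_trans ?_ (hV (winIdx i)))
      exact Finset.single_le_sum (f := fun i => (|k (σ i)| - gaussQuantile n i) ^ 2)
        (fun _ _ => sq_nonneg _) (mem_window.2 rfl)
    have hsort : f (β • k) = f (β • fun i => |k (σ i)|) := by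
      rw [hf, ← distL2_lqBall_sorted hq hlam σ (β • k)]
      congr 1
      ext i
      simp [abs_mul, abs_of_pos hβ]
    rw [hsort, abs_le, neg_le_sub_iff_le_add, ← sub_le_iff_le_add']
    constructor
    · refine distL2_sub_le_of_window (V := V) hq hlam hβ hβ1.le gaussQuantile_nonneg
        (gaussQuantile_antitone n) (fun i => by simp) fun j => ?_
      simpa only [sub_sq_comm] using hV j
    · exact distL2_sub_le_of_window (V := V) hq hlam hβ hβ1.le (fun i => abs_nonneg _) hx hB hV
  have hlip : ∀ k, |f (β • h) - f (β • k)| ≤ l2norm (h - k) := by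
    intro k
    have h1 : l2norm (β • h - β • k) ≤ l2norm (h - k) := by
      rw [← smul_sub, l2norm_smul, abs_of_pos hβ]
      exact mul_le_of_le_one_left (l2norm_nonneg _) hβ1.le
    have h2 := distL2_le_add hne (β • h) (β • k)
    have h3 := distL2_le_add hne (β • k) (β • h)
    rw [l2norm_sub_comm] at h3
    rw [abs_le]
    constructor <;> linarith
  have : |f (β • h) - f (β • gaussQuantile n)| - coreConst ≤ distL2 K h :=
    le_distL2 hKne fun k hk => by
      have h1 := abs_sub_le (f (β • h)) (f (β • k)) (f (β • gaussQuantile n))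
      linarith [hmem k hk, hlip k]
  linarith

end Core

/-! ### The shifted norm of a Gaussian vector -/

section ShiftedNorm

variable {m : ℕ}

/-- The variance of the square of a standard Gaussian variable. -/
noncomputable def sqVar : ℝ := Var[fun x => x ^ 2; gaussianReal 0 1]

/-- A radius such that both `|g₀|` and `|‖g‖ - √m|` are rarely larger. -/
noncomputable def normRadius : ℝ := 2 * Real.sqrt (1 + sqVar)

lemma sqVar_nonneg : 0 ≤ sqVar := variance_nonneg _ _

lemma normRadius_pos : 0 < normRadius := by
  have := sqVar_nonneg
  unfold normRadius; positivity

lemma normRadius_sq : normRadius ^ 2 = 4 * (1 + sqVar) := by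
  have := sqVar_nonneg
  rw [normRadius, mul_pow, Real.sq_sqrt (by positivity)]; norm_num

lemma memLp_sq_gaussianReal : MemLp (fun x : ℝ => x ^ 2) 2 (gaussianReal 0 1) := by
  have h := memLp_id_gaussianReal' (μ := 0) (v := 1) 4 (by norm_num)
  have := h.norm_rpow_div 2
  have e : (4 : ℝ≥0∞) / 2 = 2 := by
    exact ((ENNReal.eq_div_iff (by norm_num) (by norm_num)).2 (by norm_num)).symm
  rw [e] at this
  refine this.congr_norm (by fun_prop) (Eventually.of_forall fun x => ?_)
  simp

lemma integral_sq_gaussianReal : ∫ x, x ^ 2 ∂gaussianReal 0 1 = 1 := by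
  have h := variance_eq_sub (memLp_id_gaussianReal' (μ := 0) (v := 1) 2 (by norm_num))
  rw [variance_id_gaussianReal] at h
  simp only [Pi.pow_apply, id_eq, integral_id_gaussianReal] at h
  simpa using h.symm

lemma stdGaussian_radius_le_abs_coord (i : Fin m) :
    _root_.stdGaussian m {g | normRadius ≤ |g i|} ≤ ENNReal.ofReal (1 / 4) := by
  have h := meas_ge_le_variance_div_sq (memLp_id_gaussianReal' (μ := 0) (v := 1) 2 (by norm_num))
    normRadius_pos
  rw [variance_id_gaussianReal] at h
  simp only [id_eq, integral_id_gaussianReal, sub_zero] at h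
  have hmp : MeasurePreserving (Function.eval i) (_root_.stdGaussian m) (gaussianReal 0 1) :=
    measurePreserving_eval _ i
  have hset : MeasurableSet {x : ℝ | normRadius ≤ |x|} :=
    measurableSet_le measurable_const measurable_id.abs
  rw [← hmp.measure_preimage hset.nullMeasurableSet] at h
  refine le_trans h (ENNReal.ofReal_le_ofReal ?_)
  have := sqVar_nonneg
  rw [normRadius_sq, div_le_div_iff₀ (by positivity) (by norm_num)]
  norm_num
  linarith

lemma stdGaussian_radius_le_abs_norm (hm : 1 ≤ m) :
    _root_.stdGaussian m {g | normRadius ≤ |l2norm g - Real.sqrt m|} ≤ ENNReal.ofReal (1 / 4) := by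
  have hm0 : (0 : ℝ) < m := by exact_mod_cast hm
  set X : (Fin m → ℝ) → ℝ := ∑ i : Fin m, fun g => g i ^ 2 with hX
  have hXg : ∀ g, X g = l2norm g ^ 2 := fun g => by rw [l2norm_sq, hX, Finset.sum_apply]
  have hmp : ∀ i : Fin m, MeasurePreserving (Function.eval i) (_root_.stdGaussian m) (gaussianReal 0 1) :=
    fun i => measurePreserving_eval _ i
  have hmem : ∀ i : Fin m, MemLp (fun g : Fin m → ℝ => g i ^ 2) 2 (_root_.stdGaussian m) :=
    fun i => memLp_sq_gaussianReal.comp_measurePreserving (hmp i)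
  have hXmem : MemLp X 2 (_root_.stdGaussian m) := memLp_finsetSum' _ fun i _ => hmem i
  have hvar : Var[X; _root_.stdGaussian m] = m * sqVar := by
    have := variance_sum_pi (μ := fun _ : Fin m => gaussianReal 0 1)
      (X := fun _ x => x ^ 2) fun _ => memLp_sq_gaussianReal
    rw [Finset.sum_const, Finset.card_univ, Fintype.card_fin, nsmul_eq_mul] at this
    exact this
  have hmean : ∫ g, X g ∂_root_.stdGaussian m = m := by
    simp only [hX, Finset.sum_apply]
    rw [integral_finsetSum _ fun i _ => (hmem i).integrable (by norm_num)]
    have : ∀ i : Fin m, ∫ g, g i ^ 2 ∂_root_.stdGaussian m = 1 := fun i => by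
      rw [← integral_sq_gaussianReal]
      exact integral_comp_eval (μ := fun _ : Fin m => gaussianReal 0 1) (f := fun x : ℝ => x ^ 2)
        memLp_sq_gaussianReal.1
    simp [this]
  have hr := normRadius_pos
  have h := meas_ge_le_variance_div_sq hXmem (c := normRadius * Real.sqrt m) (by positivity)
  rw [hvar, hmean] at h
  refine le_trans (measure_mono fun g hg => ?_) (h.trans (ENNReal.ofReal_le_ofReal ?_))
  · rw [Set.mem_ofPred_eq] at hg ⊢
    have e : X g - m = (l2norm g - Real.sqrt m) * (l2norm g + Real.sqrt m) := by
      rw [hXg]; nth_rewrite 1 [← Real.sq_sqrt hm0.le]; ring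
    have h0 := l2norm_nonneg g
    have h1 : 0 ≤ Real.sqrt m := Real.sqrt_nonneg _
    rw [e, abs_mul, abs_of_nonneg (add_nonneg h0 h1)]
    exact mul_le_mul hg (by linarith) h1 (abs_nonneg _)
  · have := sqVar_nonneg
    rw [mul_pow, normRadius_sq, Real.sq_sqrt hm0.le, div_le_div_iff₀ (by positivity) (by norm_num)]
    nlinarith

lemma half_le_stdGaussian_norm_close (hm : 1 ≤ m) :
    1 / 2 ≤ _root_.stdGaussian m
      {g | |g ⟨0, hm⟩| ≤ normRadius ∧ |l2norm g - Real.sqrt m| ≤ normRadius} := by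
  set G := {g : Fin m → ℝ | |g ⟨0, hm⟩| ≤ normRadius ∧ |l2norm g - Real.sqrt m| ≤ normRadius} with hG
  have hc : _root_.stdGaussian m Gᶜ ≤ 1 / 2 := by
    calc _root_.stdGaussian m Gᶜ
        ≤ _root_.stdGaussian m ({g | normRadius ≤ |g ⟨0, hm⟩|} ∪
            {g | normRadius ≤ |l2norm g - Real.sqrt m|}) := by
          refine measure_mono fun g hg => ?_
          by_contra hcon
          simp only [Set.mem_union, Set.mem_ofPred_eq, not_or, not_le] at hcon
          exact hg ⟨hcon.1.le, hcon.2.le⟩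
      _ ≤ ENNReal.ofReal (1 / 4) + ENNReal.ofReal (1 / 4) :=
          (measure_union_le _ _).trans (add_le_add (stdGaussian_radius_le_abs_coord _)
            (stdGaussian_radius_le_abs_norm hm))
      _ = 1 / 2 := by
          rw [← ENNReal.ofReal_add (by norm_num) (by norm_num)]
          norm_num
          rw [one_div, ENNReal.ofReal_inv_of_pos (by norm_num)]
          norm_num
  have h1 : 1 ≤ _root_.stdGaussian m G + _root_.stdGaussian m Gᶜ := by
    rw [← measure_univ (μ := _root_.stdGaussian m), ← Set.union_compl_self G]
    exact measure_union_le _ _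
  have h2 : (1 : ℝ≥0∞) / 2 + 1 / 2 ≤ _root_.stdGaussian m G + 1 / 2 := by
    rw [ENNReal.add_halves]
    exact h1.trans (add_le_add le_rfl hc)
  exact (ENNReal.add_le_add_iff_right (by norm_num)).1 h2

lemma l2norm_smul_sub_e1_sq (hm : 1 ≤ m) (t : ℝ) (g : Fin m → ℝ) :
    l2norm (t • g - e1 m) ^ 2 = 1 + (t * l2norm g) ^ 2 - 2 * t * g ⟨0, hm⟩ := by
  have h1 : ∀ f : Fin m → ℝ, ∑ i, f i * e1 m i = f ⟨0, hm⟩ := fun f => by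
    rw [Finset.sum_eq_single ⟨0, hm⟩]
    · simp [e1]
    · intro i _ hi
      have : (i : ℕ) ≠ 0 := fun h => hi (Fin.ext h)
      simp [e1, this]
    · simp
  have h2 := h1 (e1 m)
  rw [mul_pow, l2norm_sq, l2norm_sq, ← h1 g, Finset.mul_sum, Finset.mul_sum]
  have h3 : (1 : ℝ) = ∑ i, e1 m i * e1 m i := by rw [h2]; simp [e1]
  rw [h3, ← Finset.sum_add_distrib, ← Finset.sum_sub_distrib]
  refine Finset.sum_congr rfl fun i _ => ?_
  simp only [Pi.sub_apply, Pi.smul_apply, smul_eq_mul]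
  ring

lemma abs_sub_le_of_abs_sq_sub_le {P Q c : ℝ} (hP : 0 ≤ P) (hQ : 1 ≤ Q)
    (h : |P ^ 2 - Q ^ 2| ≤ c) : |P - Q| ≤ c := by
  refine le_trans ?_ h
  have e : P ^ 2 - Q ^ 2 = (P - Q) * (P + Q) := by ring
  rw [e, abs_mul, abs_of_nonneg (by linarith : 0 ≤ P + Q)]
  exact le_mul_of_one_le_right (abs_nonneg _) (by linarith)

lemma abs_sqrt_one_add_sq_sub_le (x y : ℝ) :
    |Real.sqrt (1 + x ^ 2) - Real.sqrt (1 + y ^ 2)| ≤ |x - y| := by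
  have hx := Real.abs_le_sqrt (show x ^ 2 ≤ 1 + x ^ 2 by linarith)
  have hy := Real.abs_le_sqrt (show y ^ 2 ≤ 1 + y ^ 2 by linarith)
  have hx1 : 1 ≤ Real.sqrt (1 + x ^ 2) := Real.one_le_sqrt.2 (by nlinarith)
  have hy1 : 1 ≤ Real.sqrt (1 + y ^ 2) := Real.one_le_sqrt.2 (by nlinarith)
  set P := Real.sqrt (1 + x ^ 2) with hP
  set Q := Real.sqrt (1 + y ^ 2) with hQ
  have e : (P - Q) * (P + Q) = (x - y) * (x + y) := by
    have h1 : P ^ 2 = 1 + x ^ 2 := Real.sq_sqrt (by positivity)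
    have h2 : Q ^ 2 = 1 + y ^ 2 := Real.sq_sqrt (by positivity)
    linear_combination h1 - h2
  have h1 : |P - Q| * (P + Q) ≤ |x - y| * (P + Q) := by
    rw [← abs_of_nonneg (by linarith : 0 ≤ P + Q), ← abs_mul, e, abs_mul]
    refine mul_le_mul_of_nonneg_left ?_ (abs_nonneg _)
    rw [abs_of_nonneg (by linarith : 0 ≤ P + Q)]
    exact (abs_add_le x y).trans (add_le_add hx hy)
  exact le_of_mul_le_mul_right h1 (by linarith)

lemma abs_l2norm_smul_sub_e1_sub_le (hm : 1 ≤ m) {t : ℝ} (ht : 0 ≤ t) (g : Fin m → ℝ) :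
    |l2norm (t • g - e1 m) - Real.sqrt (((m : ℝ) - 1) * t ^ 2 + 1)| ≤
      t * (2 * |g ⟨0, hm⟩| + |l2norm g - Real.sqrt m| + 1) := by
  have hm1 : (1 : ℝ) ≤ m := by exact_mod_cast hm
  have h1 : |l2norm (t • g - e1 m) - Real.sqrt (1 + (t * l2norm g) ^ 2)| ≤
      t * (2 * |g ⟨0, hm⟩|) := by
    refine abs_sub_le_of_abs_sq_sub_le (l2norm_nonneg _)
      (Real.one_le_sqrt.2 (by nlinarith [sq_nonneg (t * l2norm g)])) ?_
    rw [l2norm_smul_sub_e1_sq hm, Real.sq_sqrt (by positivity), sub_sub_cancel_left, abs_neg, abs_mul,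
      abs_of_nonneg (by linarith : 0 ≤ 2 * t)]
    linarith
  have h2 : Real.sqrt (((m : ℝ) - 1) * t ^ 2 + 1) =
      Real.sqrt (1 + (t * Real.sqrt ((m : ℝ) - 1)) ^ 2) := by
    rw [mul_pow, Real.sq_sqrt (by linarith)]
    congr 1; ring
  have h3 := abs_sqrt_one_add_sq_sub_le (t * l2norm g) (t * Real.sqrt ((m : ℝ) - 1))
  rw [← mul_sub, abs_mul, abs_of_nonneg ht] at h3
  have h4 : |Real.sqrt m - Real.sqrt ((m : ℝ) - 1)| ≤ 1 := by
    have h5 : Real.sqrt ((m : ℝ) - 1) ≤ Real.sqrt m := Real.sqrt_le_sqrt (by linarith)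
    have h6 : 1 ≤ Real.sqrt m := Real.one_le_sqrt.2 hm1
    rw [abs_of_nonneg (by linarith)]
    have h7 : Real.sqrt m ^ 2 = m := Real.sq_sqrt (by linarith)
    have h8 : Real.sqrt ((m : ℝ) - 1) ^ 2 = m - 1 := Real.sq_sqrt (by linarith)
    nlinarith [Real.sqrt_nonneg ((m : ℝ) - 1)]
  have h5 := abs_sub_le (l2norm g) (Real.sqrt m) (Real.sqrt ((m : ℝ) - 1))
  rw [h2]
  have h6 := abs_sub_le (l2norm (t • g - e1 m)) (Real.sqrt (1 + (t * l2norm g) ^ 2))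
    (Real.sqrt (1 + (t * Real.sqrt ((m : ℝ) - 1)) ^ 2))
  have h7 : t * |l2norm g - Real.sqrt ((m : ℝ) - 1)| ≤ t * (|l2norm g - Real.sqrt m| + 1) := by
    gcongr; linarith
  linarith

lemma exists_forall_abs_l2norm_sub_le (hm : 1 ≤ m) : ∃ K : Set (Fin m → ℝ),
    1 / 2 ≤ _root_.stdGaussian m K ∧ ∀ t : ℝ, 0 ≤ t → ∀ g : Fin m → ℝ,
      |l2norm (t • g - e1 m) - Real.sqrt (((m : ℝ) - 1) * t ^ 2 + 1)| ≤
        t * (3 * normRadius + 1 + 3 * distL2 K g) := by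
  have hK := half_le_stdGaussian_norm_close hm
  refine ⟨_, hK, fun t ht g => (abs_l2norm_smul_sub_e1_sub_le hm ht g).trans
    (mul_le_mul_of_nonneg_left ?_ ht)⟩
  set K := {g : Fin m → ℝ | |g ⟨0, hm⟩| ≤ normRadius ∧ |l2norm g - Real.sqrt m| ≤ normRadius}
  have hKne : K.Nonempty := by
    by_contra hemp
    rw [Set.not_nonempty_iff_eq_empty] at hemp
    simp [hemp] at hK
  have : (2 * |g ⟨0, hm⟩| + |l2norm g - Real.sqrt m| - 3 * normRadius) / 3 ≤ distL2 K g :=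
    le_distL2 hKne fun k hk => by
      have h1 := abs_le_l2norm (g - k) ⟨0, hm⟩
      rw [Pi.sub_apply] at h1
      have h2 := abs_sub_abs_le_abs_sub (g ⟨0, hm⟩) (k ⟨0, hm⟩)
      have h3 := l2norm_add_le (g - k) k
      have h4 := l2norm_add_le (k - g) g
      rw [sub_add_cancel] at h3 h4
      rw [l2norm_sub_comm] at h4
      have h5 : |l2norm g - l2norm k| ≤ l2norm (g - k) := by rw [abs_le]; constructor <;> linarith
      have h6 := abs_sub_le (l2norm g) (l2norm k) (Real.sqrt m)
      linarith [hk.1, hk.2]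
  linarith

end ShiftedNorm

/-! ### Assembly -/

section Assembly

lemma abs_distL2_sub_integral_le {n : ℕ} {K : Set (Fin n → ℝ)}
    (hK : 1 / 2 ≤ _root_.stdGaussian n K) {f : (Fin n → ℝ) → ℝ} (hf : Continuous f) {c M : ℝ}
    (hfK : ∀ h, |f h - c| ≤ M + distL2 K h) (h : Fin n → ℝ) :
    |f h - ∫ x, f x ∂_root_.stdGaussian n| ≤ 2 * M + 4 + distL2 K h := by
  obtain ⟨hint, hle⟩ := integrable_distL2 hK
  have hg : Integrable (fun x => M + distL2 K x) (_root_.stdGaussian n) :=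
    (integrable_const M).add hint
  have hfc : Integrable (fun x => f x - c) (_root_.stdGaussian n) :=
    hg.mono' (hf.sub continuous_const).aestronglyMeasurable (Eventually.of_forall fun x => hfK x)
  have hfi : Integrable f (_root_.stdGaussian n) := by
    exact (hfc.add (integrable_const c)).congr (Eventually.of_forall fun x => sub_add_cancel _ _)
  have h1 : |∫ x, (f x - c) ∂_root_.stdGaussian n| ≤ M + 4 := by
    calc |∫ x, (f x - c) ∂_root_.stdGaussian n|
        ≤ ∫ x, |f x - c| ∂_root_.stdGaussian n := abs_integral_le_integral_abs
      _ ≤ ∫ x, (M + distL2 K x) ∂_root_.stdGaussian n := integral_mono hfc.abs hg hfK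
      _ ≤ M + 4 := by
          rw [integral_add (integrable_const M) hint]
          simpa using hle
  rw [integral_sub hfi (integrable_const c)] at h1
  simp only [integral_const, probReal_univ, one_smul] at h1
  have h2 := abs_sub_le (f h) c (∫ x, f x ∂_root_.stdGaussian n)
  rw [abs_sub_comm c] at h2
  linarith [hfK h]

/-- The universal offset in the deviation bound. -/
noncomputable def offsetConst : ℝ := 3 * normRadius + 5 + 2 * coreConst

lemma offsetConst_pos : 0 < offsetConst := by
  have := normRadius_pos
  have := coreConst_nonneg
  unfold offsetConst; positivity

lemma exists_forall_abs_phiFun_sub_kappaFun_le {m n : ℕ} (hm : 1 ≤ m) (hn : 0 < n) :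
    ∃ (K₁ : Set (Fin m → ℝ)) (K₂ : Set (Fin n → ℝ)), 1 / 2 ≤ _root_.stdGaussian m K₁ ∧
      1 / 2 ≤ _root_.stdGaussian n K₂ ∧ ∀ lam : ℝ, 0 ≤ lam → ∀ q : ℝ≥0∞, 1 ≤ q →
        ∀ α β : ℝ, 0 < α → 0 < β → β < 1 → ∀ g h,
          |phiFun q lam m n α β g h - kappaFun q lam n (((m : ℝ) - 1) / n) α β| ≤
            α / Real.sqrt n * (offsetConst + 3 * distL2 K₁ g + distL2 K₂ h) := by
  obtain ⟨K₁, hK₁, hg⟩ := exists_forall_abs_l2norm_sub_le hm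
  obtain ⟨K₂, hK₂, hh⟩ := exists_forall_abs_distL2_sub_le n
  refine ⟨K₁, K₂, hK₁, hK₂, fun lam hlam q hq α β hα hβ hβ1 g h => ?_⟩
  have hn0 : (0 : ℝ) < n := by exact_mod_cast hn
  have hne : ({w : Fin n → ℝ | lqNorm q w ≤ lam}).Nonempty := ⟨0, zero_mem_lqBall hq hlam⟩
  have hF := abs_distL2_sub_integral_le hK₂
    (f := fun x => distL2 {w : Fin n → ℝ | lqNorm q w ≤ lam} (β • x))
    ((continuous_distL2 hne).comp (continuous_const_smul β))
    (hh q hq lam hlam β hβ hβ1) h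
  set t := α / Real.sqrt n with ht
  have ht0 : 0 ≤ t := by positivity
  have hG := hg t ht0 g
  have hsq : ((m : ℝ) - 1) / n * α ^ 2 + 1 = ((m : ℝ) - 1) * t ^ 2 + 1 := by
    rw [ht, div_pow, Real.sq_sqrt hn0.le]; ring
  have e : phiFun q lam m n α β g h - kappaFun q lam n (((m : ℝ) - 1) / n) α β =
      β * (l2norm (t • g - e1 m) - Real.sqrt (((m : ℝ) - 1) * t ^ 2 + 1)) -
        t * (distL2 {w | lqNorm q w ≤ lam} (β • h) -
          ∫ x, distL2 {w : Fin n → ℝ | lqNorm q w ≤ lam} (β • x) ∂_root_.stdGaussian n) := by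
    rw [phiFun, kappaFun, Deltap, hsq, ← ht]
    have : α * (1 / Real.sqrt n * ∫ x, distL2 {w : Fin n → ℝ | lqNorm q w ≤ lam} (β • x)
        ∂_root_.stdGaussian n) = t * ∫ x, distL2 {w : Fin n → ℝ | lqNorm q w ≤ lam} (β • x)
        ∂_root_.stdGaussian n := by rw [ht]; ring
    rw [this]
    ring
  rw [e]
  refine (abs_sub _ _).trans ?_
  rw [abs_mul, abs_mul, abs_of_pos hβ, abs_of_nonneg ht0]
  have h1 := (mul_le_of_le_one_left (abs_nonneg _) hβ1.le).trans hG
  have h2 := mul_le_mul_of_nonneg_left hF ht0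
  refine (add_le_add h1 h2).trans_eq ?_
  rw [offsetConst]
  ring

lemma stdGaussian_prod_deviation_le {m n : ℕ} {K₁ : Set (Fin m → ℝ)} {K₂ : Set (Fin n → ℝ)}
    (hK₁ : 1 / 2 ≤ _root_.stdGaussian m K₁) (hK₂ : 1 / 2 ≤ _root_.stdGaussian n K₂) {s : ℝ}
    (hs : 0 ≤ s) :
    ((_root_.stdGaussian m).prod (_root_.stdGaussian n))
        {gh | 4 * s ≤ 3 * distL2 K₁ gh.1 + distL2 K₂ gh.2} ≤
      ENNReal.ofReal (4 * Real.exp (-(s ^ 2 / 4))) := by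
  calc ((_root_.stdGaussian m).prod (_root_.stdGaussian n))
        {gh | 4 * s ≤ 3 * distL2 K₁ gh.1 + distL2 K₂ gh.2}
      ≤ ((_root_.stdGaussian m).prod (_root_.stdGaussian n))
          (({g | s ≤ distL2 K₁ g} ×ˢ Set.univ) ∪ (Set.univ ×ˢ {h | s ≤ distL2 K₂ h})) := by
        refine measure_mono fun gh hgh => ?_
        by_contra hcon
        simp only [Set.mem_union, Set.mem_prod, Set.mem_ofPred_eq, Set.mem_univ, and_true,
          true_and, not_or, not_le] at hcon hgh
        linarith [hcon.1, hcon.2]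
    _ ≤ ENNReal.ofReal (2 * Real.exp (-(s ^ 2 / 4))) + ENNReal.ofReal (2 * Real.exp (-(s ^ 2 / 4))) := by
        refine (measure_union_le _ _).trans (add_le_add ?_ ?_)
        · rw [Measure.prod_prod, measure_univ, mul_one]
          exact stdGaussian_distL2_ge_le hK₁ hs
        · rw [Measure.prod_prod, measure_univ, one_mul]
          exact stdGaussian_distL2_ge_le hK₂ hs
    _ = _ := by
        rw [← ENNReal.ofReal_add (by positivity) (by positivity)]
        congr 1; ring

end Assembly

/-- Uniform concentration of `φ(α, β; g, h)` around `κ(α, β)` over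
`0 < α ≤ A`, `0 < β < 1`, for independent standard Gaussian vectors `g ∼ N(0, I_m)`,
`h ∼ N(0, I_n)`, with universal constants `c₁, c₂ > 0`. Here `q = p*` is the Hölder
conjugate of `p ∈ [1, ∞]`. -/
theorem phi_concentrates_around_kappa :
    ∃ c₁ c₂ : ℝ, 0 < c₁ ∧ 0 < c₂ ∧
      ∀ m n : ℕ, 1 ≤ m → m < n →
        ∀ δ : ℝ, δ = ((m : ℝ) - 1) / n →
        ∀ lam : ℝ, 0 ≤ lam →
        ∀ p q : ℝ≥0∞, 1 ≤ p → 1 / p + 1 / q = 1 →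
        ∀ A : ℝ, 0 < A →
        ∀ ε : ℝ, 0 < ε → ε < 2 →
          ((stdGaussian m).prod (stdGaussian n))
              {gh : (Fin m → ℝ) × (Fin n → ℝ) |
                ∃ α β : ℝ, 0 < α ∧ α ≤ A ∧ 0 < β ∧ β < 1 ∧
                  ε ≤ |phiFun q lam m n α β gh.1 gh.2 - kappaFun q lam n δ α β|} ≤
            ENNReal.ofReal ((c₁ / ε) *
              Real.exp (-c₂ * ε ^ 2 * n * (min δ (1 / A ^ 2) / (1 + δ * A ^ 2)))) := by
  have hC := offsetConst_pos
  refine ⟨8 * Real.exp (4 * offsetConst ^ 2 / 256), 1 / 256, by positivity, by norm_num, ?_⟩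
  intro m n hm hmn δ hδ lam hlam p q _ hpq A hA ε hε hε2
  have hq : 1 ≤ q := by
    rw [← ENNReal.inv_le_one, ← one_div]
    exact (le_add_self : 1 / q ≤ 1 / p + 1 / q).trans_eq hpq
  have hn : 0 < n := by omega
  have hn0 : (0 : ℝ) < n := by exact_mod_cast hn
  have hm1 : (1 : ℝ) ≤ m := by exact_mod_cast hm
  have hδ0 : 0 ≤ δ := by rw [hδ]; exact div_nonneg (by linarith) hn0.le
  obtain ⟨K₁, K₂, hK₁, hK₂, hdev⟩ := exists_forall_abs_phiFun_sub_kappaFun_le (n := n) hm hn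
  set T := ε * Real.sqrt n / A with hT
  have hT0 : 0 < T := by positivity
  set Q := ε ^ 2 * n * (min δ (1 / A ^ 2) / (1 + δ * A ^ 2)) with hQ
  have hQT : Q ≤ T ^ 2 := by
    have h1 : min δ (1 / A ^ 2) / (1 + δ * A ^ 2) ≤ 1 / A ^ 2 :=
      (div_le_self (le_min hδ0 (by positivity)) (by nlinarith [mul_nonneg hδ0 (sq_nonneg A)])).trans
        (min_le_right _ _)
    have h2 : T ^ 2 = ε ^ 2 * n * (1 / A ^ 2) := by
      rw [hT, div_pow, mul_pow, Real.sq_sqrt hn0.le]; ring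
    rw [h2, hQ]
    gcongr
  have hsub : {gh : (Fin m → ℝ) × (Fin n → ℝ) | ∃ α β : ℝ, 0 < α ∧ α ≤ A ∧ 0 < β ∧ β < 1 ∧
      ε ≤ |phiFun q lam m n α β gh.1 gh.2 - kappaFun q lam n δ α β|} ⊆
      {gh | T - offsetConst ≤ 3 * distL2 K₁ gh.1 + distL2 K₂ gh.2} := by
    rintro ⟨g, h⟩ ⟨α, β, hα, hαA, hβ, hβ1, hle⟩
    rw [hδ] at hle
    have h1 := hle.trans (hdev lam hlam q hq α β hα hβ hβ1 g h)
    have h0 : 0 ≤ offsetConst + 3 * distL2 K₁ g + distL2 K₂ h := by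
      have := distL2_nonneg K₁ g
      have := distL2_nonneg K₂ h
      positivity
    have h2 : ε ≤ A / Real.sqrt n * (offsetConst + 3 * distL2 K₁ g + distL2 K₂ h) :=
      h1.trans (by gcongr)
    have hsn : 0 < Real.sqrt n := Real.sqrt_pos.2 hn0
    rw [div_mul_eq_mul_div, le_div_iff₀ hsn] at h2
    rw [Set.mem_ofPred_eq, sub_le_iff_le_add, hT, div_le_iff₀ hA]
    linarith
  set P := 8 * Real.exp (4 * offsetConst ^ 2 / 256) with hP
  have hPε : P / 2 ≤ P / ε := by gcongr
  have hexp : -(1 / 256) * ε ^ 2 * n * (min δ (1 / A ^ 2) / (1 + δ * A ^ 2)) = -(Q / 256) := by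
    rw [hQ]; ring
  rw [hexp]
  by_cases hTC : T < 2 * offsetConst
  · refine prob_le_one.trans (ENNReal.one_le_ofReal.2 ?_)
    have h1 : Q ≤ 4 * offsetConst ^ 2 := hQT.trans (by nlinarith)
    calc (1 : ℝ) ≤ P / 2 * Real.exp (-(Q / 256)) := by
          have h2 : 1 ≤ Real.exp (4 * offsetConst ^ 2 / 256 + -(Q / 256)) :=
            Real.one_le_exp (by linarith)
          rw [Real.exp_add] at h2
          rw [hP]
          linarith
      _ ≤ _ := by gcongr
  · push Not at hTC
    have hs : 0 ≤ (T - offsetConst) / 4 := by linarith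
    refine (measure_mono hsub).trans ?_
    have h1 := stdGaussian_prod_deviation_le hK₁ hK₂ hs
    rw [mul_div_cancel₀ _ (by norm_num : (4 : ℝ) ≠ 0)] at h1
    refine h1.trans (ENNReal.ofReal_le_ofReal ?_)
    have h2 : Q / 256 ≤ ((T - offsetConst) / 4) ^ 2 / 4 := by
      have h3 : (T / 2) ^ 2 ≤ (T - offsetConst) ^ 2 :=
        pow_le_pow_left₀ (by positivity) (by linarith) 2
      linarith
    have h4 : (4 : ℝ) ≤ P / ε := by
      refine le_trans ?_ hPε
      have : 1 ≤ Real.exp (4 * offsetConst ^ 2 / 256) := Real.one_le_exp (by positivity)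
      rw [hP]; linarith
    have hPpos : 0 ≤ P / ε := by positivity
    gcongr
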